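/- Let f ∈ H²(𝔹). Then the following are equivalent: (i) f is inner; (ii) for all k ∈ ℕ, ⟨qᵏ * f, f⟩ = δ_k(0) (i.e. the inner product equals 1 if k = 0 and 0 otherwise); (iii) there exists I ∈ 𝕊 such that for all k ∈ ℕ, ⟨qᵏ * f, f⟩_I = δ_k(0), where ⟨f, g⟩_I = (1/2π) ∫₀^{2π} conj(g(e^{θI})) f(e^{θI}) dθ. -/

import Mathlib

open MeasureTheory Filter Topology
open scoped ENNReal Classical

noncomputable section

/-! ### Basic quaternionic notions -/

instance : MeasurableSpace (Quaternion ℝ) := borel _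
instance : BorelSpace (Quaternion ℝ) := ⟨rfl⟩

/-- The 2-sphere `𝕊` of quaternionic imaginary units. -/
def USphere : Set (Quaternion ℝ) := {q | q ^ 2 = -1}

/-- The open quaternionic unit ball `𝔹`. -/
def QBall : Set (Quaternion ℝ) := {q | ‖q‖ < 1}

/-- The slice `L_I = ℝ + ℝI` through an imaginary unit `I`. -/
def sliceSet (I : Quaternion ℝ) : Set (Quaternion ℝ) :=
  {q | ∃ x y : ℝ, q = (x : Quaternion ℝ) + y • I}

/-- The point `e^{tI} = cos t + (sin t) I` of the boundary circle `∂𝔹_I`. -/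
def ptOn (I : Quaternion ℝ) (t : ℝ) : Quaternion ℝ :=
  ((Real.cos t : ℝ) : Quaternion ℝ) + Real.sin t • I

/-- Slice regularity on the unit ball: on every slice the restriction of `f` has partial
derivatives satisfying the Cauchy–Riemann equation `∂f/∂x + I ∂f/∂y = 0`. -/
def SliceRegular (f : Quaternion ℝ → Quaternion ℝ) : Prop :=
  ∀ I ∈ USphere, ∀ x y : ℝ, ((x : Quaternion ℝ) + y • I) ∈ QBall →
    ∃ fx fy : Quaternion ℝ,
      HasDerivAt (fun s : ℝ => f ((s : Quaternion ℝ) + y • I)) fx x ∧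
      HasDerivAt (fun t : ℝ => f ((x : Quaternion ℝ) + t • I)) fy y ∧
      fx + I * fy = 0

/-! ### The Hardy space `H²(𝔹)` via power series coefficients.
A slice regular function on `𝔹` is identified with its coefficient sequence
`a : ℕ → ℍ`, the function being `q ↦ ∑ qⁿ aₙ`. -/

/-- Membership in `H²(𝔹)`: square-summable coefficients. -/
def MemH2 (a : ℕ → Quaternion ℝ) : Prop := Summable (fun n => ‖a n‖ ^ 2)

/-- Evaluation of the power series `q ↦ ∑ qⁿ aₙ`. -/
def evalS (a : ℕ → Quaternion ℝ) (q : Quaternion ℝ) : Quaternion ℝ := ∑' n, q ^ n * a n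

/-- The `*`-product (slice product) on coefficient sequences. -/
def sProd (a b : ℕ → Quaternion ℝ) : ℕ → Quaternion ℝ :=
  fun n => ∑ k ∈ Finset.range (n + 1), a k * b (n - k)

/-- The regular conjugate `fᶜ`. -/
def conjS (a : ℕ → Quaternion ℝ) : ℕ → Quaternion ℝ := fun n => star (a n)

/-- The symmetrization `fˢ = f * fᶜ`. -/
def symmS (a : ℕ → Quaternion ℝ) : ℕ → Quaternion ℝ := sProd a (conjS a)

/-- The squared `H²` norm `∑ ‖aₙ‖²`. -/
def h2normSq (a : ℕ → Quaternion ℝ) : ℝ := ∑' n, ‖a n‖ ^ 2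

/-- The `H²` norm. -/
def h2norm (a : ℕ → Quaternion ℝ) : ℝ := Real.sqrt (h2normSq a)

/-- The (right) quaternionic inner product `⟨f,g⟩ = ∑ conj(bₙ) aₙ` of `H²(𝔹)`. -/
def h2inner (a b : ℕ → Quaternion ℝ) : Quaternion ℝ := ∑' n, star (b n) * a n

/-- Squared `H²`-distance of two coefficient sequences (valued in `ℝ≥0∞`). -/
def h2distSq (a b : ℕ → Quaternion ℝ) : ℝ≥0∞ := ∑' n, (‖a n - b n‖₊ : ℝ≥0∞) ^ 2

/-- The boundary value function of `f ∈ H²(𝔹)`, given by the radial limit where it exists. -/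
def bdval (a : ℕ → Quaternion ℝ) (q : Quaternion ℝ) : Quaternion ℝ :=
  if h : ∃ L, Tendsto (fun r : ℝ => evalS a ((r : Quaternion ℝ) * q)) (𝓝[<] (1 : ℝ)) (𝓝 L)
  then h.choose else 0

/-! ### The measure `Σ` on `∂𝔹` with `dΣ(e^{tI}) = dσ(I) dt`. -/

/-- The normalized area measure `σ` on the sphere `𝕊` of imaginary units
(2-dimensional Hausdorff measure, normalized so that `σ(𝕊) = 1`). -/
def sphMeasure : Measure (Quaternion ℝ) := (μH[2] USphere)⁻¹ • (μH[2]).restrict USphere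

/-- The measure `Σ` on `∂𝔹`, `dΣ(e^{tI}) = dσ(I) dt`, normalized so `Σ(∂𝔹) = 1`. -/
def SigmaBd : Measure (Quaternion ℝ) :=
  (ENNReal.ofReal (2 * Real.pi))⁻¹ •
    Measure.map (fun p : ℝ × Quaternion ℝ => ptOn p.2 p.1)
      ((volume.restrict (Set.Ico 0 (2 * Real.pi))).prod sphMeasure)

/-! ### Inner, outer, cyclic -/

/-- `f ∈ H^∞(𝔹)`: a bounded function of `H²(𝔹)`. -/
def MemHinf (a : ℕ → Quaternion ℝ) : Prop :=
  MemH2 a ∧ ∃ C : ℝ, ∀ q ∈ QBall, ‖evalS a q‖ ≤ C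

/-- The `H^∞` norm: the sup of `‖f‖` on the ball. -/
def hInfNorm (a : ℕ → Quaternion ℝ) : ℝ := sSup ((fun q => ‖evalS a q‖) '' QBall)

/-- `f` is inner: `f ∈ H^∞(𝔹)`, `‖f‖ ≤ 1` on `𝔹` and `‖f‖ = 1` `Σ`-a.e. on `∂𝔹`. -/
def IsInnerQ (a : ℕ → Quaternion ℝ) : Prop :=
  MemH2 a ∧ (∀ q ∈ QBall, ‖evalS a q‖ ≤ 1) ∧ (∀ᵐ q ∂SigmaBd, ‖bdval a q‖ = 1)

/-- `g` is outer: whenever `f ∈ H²(𝔹)` has the same boundary modulus `Σ`-a.e.,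
then `‖g‖ ≥ ‖f‖` throughout `𝔹`. -/
def IsOuterQ (g : ℕ → Quaternion ℝ) : Prop :=
  MemH2 g ∧ ∀ f, MemH2 f → (∀ᵐ q ∂SigmaBd, ‖bdval g q‖ = ‖bdval f q‖) →
    ∀ q ∈ QBall, ‖evalS f q‖ ≤ ‖evalS g q‖

/-- Quaternionic polynomials (finitely supported coefficient sequences). -/
def IsPolyQ (p : ℕ → Quaternion ℝ) : Prop := ∃ N, ∀ n > N, p n = 0

/-- Quaternionic polynomials of degree at most `n` (the space `𝒫_n`). -/
def IsPolyDeg (p : ℕ → Quaternion ℝ) (n : ℕ) : Prop := ∀ m > n, p m = 0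

/-- The coefficient sequence of the monomial `qᵏ`. -/
def qpow (k : ℕ) : ℕ → Quaternion ℝ := fun n => if n = k then 1 else 0

/-- The coefficient sequence of a constant function. -/
def constS (c : Quaternion ℝ) : ℕ → Quaternion ℝ := fun n => if n = 0 then c else 0

/-- The coefficient sequence of the constant function `1`. -/
def oneS : ℕ → Quaternion ℝ := constS 1

/-- The invariant subspace `[g]`: the `H²`-closure of `{g * p : p polynomial}`,
i.e. of the right span of `{qⁿ * g : n ≥ 0}`. -/
def InvSub (g : ℕ → Quaternion ℝ) : Set (ℕ → Quaternion ℝ) :=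
  {h | MemH2 h ∧ ∀ ε : ℝ≥0∞, 0 < ε → ∃ p, IsPolyQ p ∧ h2distSq (sProd g p) h < ε}

/-- `g` is cyclic: `[g] = H²(𝔹)`. -/
def IsCyclicQ (g : ℕ → Quaternion ℝ) : Prop :=
  MemH2 g ∧ ∀ h, MemH2 h → h ∈ InvSub g

/-! ### Bilateral (slice `L²`) series, used for boundary products -/

/-- Bilateral coefficients of `f̃(q) = f(q̄)` on `∂𝔹`: `Σ_{n ≤ 0} qⁿ a_{-n}`. -/
def tildeZ (a : ℕ → Quaternion ℝ) : ℤ → Quaternion ℝ :=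
  fun k => if k ≤ 0 then a (-k).toNat else 0

/-- Bilateral coefficients of `fᶜ` on `∂𝔹`. -/
def conjZ (a : ℕ → Quaternion ℝ) : ℤ → Quaternion ℝ :=
  fun k => if 0 ≤ k then star (a k.toNat) else 0

/-- The `*`-product of two slice `L²` functions on the boundary, on coefficients. -/
def convZ (c b : ℤ → Quaternion ℝ) : ℤ → Quaternion ℝ := fun n => ∑' k : ℤ, c k * b (n - k)

/-- Evaluation of a bilateral series `q ↦ ∑_{n ∈ ℤ} qⁿ dₙ`. -/
def evalZ (d : ℤ → Quaternion ℝ) (q : Quaternion ℝ) : Quaternion ℝ := ∑' n : ℤ, q ^ n * d n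

/-- The slice inner product `⟨qᵏ * f, f⟩_I = (1/2π)∫₀^{2π} conj(f(e^{θI})) (e^{θI})ᵏ f(e^{θI}) dθ`,
computed with boundary values; note `(qᵏ * f)(q) = qᵏ f(q)` pointwise. -/
def sliceInnerPow (a : ℕ → Quaternion ℝ) (I : Quaternion ℝ) (k : ℕ) : Quaternion ℝ :=
  (2 * Real.pi)⁻¹ •
    ∫ t in Set.Ico 0 (2 * Real.pi), star (bdval a (ptOn I t)) * ((ptOn I t) ^ k * bdval a (ptOn I t))

/-! ### Complex Hardy space `H²(𝔻)` notions (for slice restrictions) -/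

/-- Membership in the complex Hardy space `H²(𝔻)` via coefficients. -/
def CMemH2 (c : ℕ → ℂ) : Prop := Summable (fun n => ‖c n‖ ^ 2)

/-- Evaluation of a complex power series. -/
def cEval (c : ℕ → ℂ) (z : ℂ) : ℂ := ∑' n, z ^ n * c n

/-- Cauchy product of complex coefficient sequences. -/
def cConv (c d : ℕ → ℂ) : ℕ → ℂ := fun n => ∑ k ∈ Finset.range (n + 1), c k * d (n - k)

/-- Squared `H²(𝔻)` distance. -/
def cDistSq (c d : ℕ → ℂ) : ℝ≥0∞ := ∑' n, (‖c n - d n‖₊ : ℝ≥0∞) ^ 2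

/-- Radial boundary values of a complex `H²` function. -/
def cBdval (c : ℕ → ℂ) (z : ℂ) : ℂ :=
  if h : ∃ L, Tendsto (fun r : ℝ => cEval c ((r : ℂ) * z)) (𝓝[<] (1 : ℝ)) (𝓝 L)
  then h.choose else 0

/-- Lebesgue measure on the unit circle `∂𝔻` (parametrized by `θ ∈ [0, 2π)`). -/
def circleM : Measure ℂ :=
  Measure.map (fun t : ℝ => Complex.exp (t * Complex.I)) (volume.restrict (Set.Ico 0 (2 * Real.pi)))

/-- Cyclicity in `H²(𝔻)`: polynomial multiples of `c` are dense. -/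
def CIsCyclic (c : ℕ → ℂ) : Prop :=
  CMemH2 c ∧ ∀ h, CMemH2 h → ∀ ε : ℝ≥0∞, 0 < ε →
    ∃ p : ℕ → ℂ, (∃ N, ∀ n > N, p n = 0) ∧ cDistSq (cConv c p) h < ε

/-- Outerness in `H²(𝔻)` (in the sense matching Definition 2.10 of the paper). -/
def CIsOuter (c : ℕ → ℂ) : Prop :=
  CMemH2 c ∧ ∀ h, CMemH2 h →
    (∀ᵐ z ∂circleM, ‖cBdval c z‖ = ‖cBdval h z‖) →
    ∀ z ∈ Metric.ball (0 : ℂ) 1, ‖cEval h z‖ ≤ ‖cEval c z‖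

/-- Complex coordinates of a point of the slice `L_I`: if `p = x + yI` then
`sliceToC I p = x + iy`. -/
def sliceToC (I : Quaternion ℝ) (p : Quaternion ℝ) : ℂ := ⟨p.re, -(p * I).re⟩

/-- The quaternion `i`. -/
def qI : Quaternion ℝ := ⟨0, 1, 0, 0⟩

/-- The embedding of `ℂ = L_i` into the quaternions. -/
def cToQ (z : ℂ) : Quaternion ℝ := (z.re : Quaternion ℝ) + z.im • qI

/-- The imaginary unit `I_ω` identified by `ω` (any imaginary unit if `ω` is real). -/
def Iu (ω : Quaternion ℝ) : Quaternion ℝ := if ω.im = 0 then qI else ‖ω.im‖⁻¹ • ω.im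

/-! ### Optimal approximants -/

/-- `p` is an optimal approximant of degree `n` of `f^{-*}`: `p ∈ 𝒫_n` minimizes
`‖f * p - 1‖_{H²}` among all `p ∈ 𝒫_n`. -/
def IsOptApprox (a : ℕ → Quaternion ℝ) (n : ℕ) (p : ℕ → Quaternion ℝ) : Prop :=
  IsPolyDeg p n ∧ ∀ r, IsPolyDeg r n → h2distSq (sProd a p) oneS ≤ h2distSq (sProd a r) oneS

end
lemma hasSum_congr_fun {ι : Type*} {f g : ι → ℂ} {a : ℂ} (h : ∀ n, f n = g n) (hg : HasSum g a) :
    HasSum f a := by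
  rw [funext h]; exact hg

/-- The Poisson kernel of the disc. -/
noncomputable def poisP (r s : ℝ) : ℝ := (1 - r ^ 2) / (1 - 2 * r * Real.cos s + r ^ 2)

noncomputable def poisP' (r s : ℝ) : ℝ :=
  -((1 - r ^ 2) * (2 * r * Real.sin s)) / (1 - 2 * r * Real.cos s + r ^ 2) ^ 2

lemma poisD_pos {r : ℝ} (h0 : 0 ≤ r) (h1 : r < 1) (s : ℝ) :
    0 < 1 - 2 * r * Real.cos s + r ^ 2 := by
  nlinarith [Real.cos_le_one s, Real.neg_one_le_cos s]

lemma poisP_nonneg {r : ℝ} (h0 : 0 ≤ r) (h1 : r < 1) (s : ℝ) : 0 ≤ poisP r s := by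
  unfold poisP
  have := poisD_pos h0 h1 s
  apply div_nonneg _ this.le
  nlinarith

lemma poisP_hasDerivAt {r : ℝ} (h0 : 0 ≤ r) (h1 : r < 1) (s : ℝ) :
    HasDerivAt (poisP r) (poisP' r s) s := by
  have hD := poisD_pos h0 h1 s
  have h : HasDerivAt (fun s => 1 - 2 * r * Real.cos s + r ^ 2) (2 * r * Real.sin s) s := by
    have := (((Real.hasDerivAt_cos s).const_mul (2 * r)).const_sub 1).add_const (r ^ 2)
    exact this.congr_deriv (by ring)
  have := (hasDerivAt_const s (1 - r ^ 2)).div h hD.ne'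
  refine this.congr_deriv ?_
  unfold poisP'; ring

lemma poisP_contDiff {r : ℝ} (h0 : 0 ≤ r) (h1 : r < 1) : ContDiff ℝ 1 (poisP r) := by
  unfold poisP
  apply ContDiff.div
  · fun_prop
  · fun_prop
  · intro s; exact (poisD_pos h0 h1 s).ne'

lemma poisP_cont {r : ℝ} (h0 : 0 ≤ r) (h1 : r < 1) : Continuous (poisP r) :=
  (poisP_contDiff h0 h1).continuous

lemma poisP'_cont {r : ℝ} (h0 : 0 ≤ r) (h1 : r < 1) : Continuous (poisP' r) := by
  unfold poisP'
  apply Continuous.div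
  · fun_prop
  · fun_prop
  · intro s; exact pow_ne_zero _ (poisD_pos h0 h1 s).ne'

lemma poisP_hasSum {r : ℝ} (h0 : 0 ≤ r) (h1 : r < 1) (s : ℝ) :
    HasSum (fun n : ℤ => ((r ^ n.natAbs : ℝ) : ℂ) * Complex.exp (-(n * s * Complex.I)))
      ((poisP r s : ℝ) : ℂ) := by
  set z : ℂ := r * Complex.exp (-(s * Complex.I)) with hz
  set w : ℂ := r * Complex.exp (s * Complex.I) with hw
  have nz : ‖z‖ < 1 := by
    rw [hz, norm_mul, ← neg_mul, ← Complex.ofReal_neg, Complex.norm_exp_ofReal_mul_I]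
    simpa [abs_of_nonneg h0] using h1
  have nw : ‖w‖ < 1 := by
    rw [hw, norm_mul, Complex.norm_exp_ofReal_mul_I]
    simpa [abs_of_nonneg h0] using h1
  have H1 := hasSum_geometric_of_norm_lt_one nz
  have H2 := (hasSum_geometric_of_norm_lt_one nw).mul_left w
  have key : (1 - z)⁻¹ + w * (1 - w)⁻¹ = ((poisP r s : ℝ) : ℂ) := by
    have hz1 : (1 - z) ≠ 0 := by
      intro h; have : z = 1 := by linear_combination -h
      rw [this] at nz; simp at nz
    have hw1 : (1 - w) ≠ 0 := by
      intro h; have : w = 1 := by linear_combination -h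
      rw [this] at nw; simp at nw
    have hzw : z * w = r ^ 2 := by
      rw [hz, hw, mul_mul_mul_comm, ← Complex.exp_add]; simp; ring
    have hzw2 : z + w = 2 * r * Complex.cos s := by
      rw [hz, hw, Complex.cos]; simp only [neg_mul]; ring
    have hD : (1 - 2 * r * Complex.cos s + r ^ 2 : ℂ) = (1 - z) * (1 - w) := by
      linear_combination (-1 : ℂ) * hzw + hzw2
    unfold poisP
    push_cast
    rw [hD]
    field_simp
    linear_combination -hzw
  rw [← key]
  apply HasSum.of_nat_of_neg_add_one
  · refine hasSum_congr_fun (fun n => ?_) H1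
    rw [hz, mul_pow, ← Complex.exp_nat_mul]
    simp; left; congr 1; ring
  · refine hasSum_congr_fun (fun n => ?_) H2
    have : (-((n:ℤ) + 1)).natAbs = n + 1 := by omega
    rw [this, ← pow_succ', hw, mul_pow, ← Complex.exp_nat_mul]
    push_cast
    congr 2; ring

/-- Fourier coefficients on the line. -/
noncomputable def fhat (u : ℝ → ℂ) (n : ℤ) : ℂ :=
  (2 * Real.pi : ℝ)⁻¹ * ∫ x in (0)..(2 * Real.pi), Complex.exp (-(n * x * Complex.I)) * u x

lemma summable_natAbs {r : ℝ} (h0 : 0 ≤ r) (h1 : r < 1) : Summable (fun n : ℤ => r ^ n.natAbs) := by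
  apply Summable.of_nat_of_neg <;> simpa using summable_geometric_of_lt_one h0 h1

lemma exp_periodic (n : ℤ) : Function.Periodic (fun x : ℝ => Complex.exp (-(n * x * Complex.I)))
    (2 * Real.pi) := by
  intro x
  simp only
  rw [Complex.exp_eq_exp_iff_exists_int]
  exact ⟨-n, by push_cast; ring⟩

lemma pois_rep {r : ℝ} (h0 : 0 ≤ r) (h1 : r < 1) (u : ℝ → ℂ)
    (hp : Function.Periodic u (2 * Real.pi)) (hu : ∀ a b, IntervalIntegrable u volume a b) (t : ℝ) :
    HasSum (fun n : ℤ => ((r ^ n.natAbs : ℝ) : ℂ) * (Complex.exp (n * t * Complex.I) * fhat u n))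
      ((2 * Real.pi : ℝ)⁻¹ * ∫ s in (-Real.pi)..Real.pi, (poisP r s : ℂ) * u (t + s)) := by
  have hut : IntervalIntegrable (fun s => u (t + s)) volume (-Real.pi) Real.pi := by
    have := (hu (-Real.pi + t) (Real.pi + t)).comp_add_left t
    simpa using this
  have H : HasSum (fun n : ℤ => ∫ s in (-Real.pi)..Real.pi,
      ((r ^ n.natAbs : ℝ) : ℂ) * Complex.exp (-(n * s * Complex.I)) * u (t + s))
      (∫ s in (-Real.pi)..Real.pi, (poisP r s : ℂ) * u (t + s)) := by
    apply intervalIntegral.hasSum_integral_of_dominated_convergence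
      (fun n s => r ^ n.natAbs * ‖u (t + s)‖)
    · intro n
      apply AEStronglyMeasurable.mul
      · exact Continuous.aestronglyMeasurable (by fun_prop)
      · exact hut.def'.aestronglyMeasurable
    · intro n
      filter_upwards with s _
      rw [norm_mul, norm_mul, ← neg_mul]
      have : (-(↑n * ↑s) * Complex.I : ℂ) = ((-(n * s) : ℝ) : ℂ) * Complex.I := by push_cast; ring
      rw [this, Complex.norm_exp_ofReal_mul_I, Complex.norm_real, Real.norm_eq_abs,
        abs_of_nonneg (pow_nonneg h0 _), mul_one]
    · filter_upwards with s _
      exact (summable_natAbs h0 h1).mul_right _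
    · simp_rw [tsum_mul_right]
      exact hut.norm.const_mul _
    · filter_upwards with s _
      exact (poisP_hasSum h0 h1 s).mul_right _
  refine hasSum_congr_fun (fun n => ?_) (H.mul_left (((2 * Real.pi : ℝ)⁻¹ : ℝ) : ℂ))
  unfold fhat
  simp_rw [mul_assoc]
  rw [intervalIntegral.integral_const_mul]
  have : ∫ s in (-Real.pi)..Real.pi, Complex.exp (-(n * (s * Complex.I))) * u (t + s) =
      Complex.exp (n * (t * Complex.I)) *
      ∫ x in (0)..(2 * Real.pi), Complex.exp (-(n * (x * Complex.I))) * u x := by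
    have e1 : ∀ s : ℝ, Complex.exp (-(n * (s * Complex.I))) * u (t + s) =
      Complex.exp (n * (t * Complex.I)) *
        (fun x : ℝ => Complex.exp (-(n * (x * Complex.I))) * u x) (t + s) := by
      intro s
      simp only
      rw [← mul_assoc (Complex.exp _), ← Complex.exp_add]
      congr 2; push_cast; ring
    simp_rw [e1]
    rw [intervalIntegral.integral_const_mul]
    congr 1
    rw [intervalIntegral.integral_comp_add_left (fun x : ℝ => Complex.exp (-(n * (x * Complex.I))) * u x) t]
    have hper : Function.Periodic (fun x : ℝ => Complex.exp (-(n * (x * Complex.I))) * u x) (2 * Real.pi) := by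
      have := (exp_periodic n).mul hp
      simpa [mul_assoc, Pi.mul_def] using this
    have := hper.intervalIntegral_add_eq (t + -Real.pi) 0
    rw [zero_add] at this
    rw [← this]
    congr 1; ring
  rw [this]
  push_cast; ring

lemma poisP_integral {r : ℝ} (h0 : 0 ≤ r) (h1 : r < 1) :
    ∫ s in (-Real.pi)..Real.pi, poisP r s = 2 * Real.pi := by
  have H := pois_rep h0 h1 (fun _ => 1) (fun _ => rfl) (fun a b => by simp) 0
  have h2 : ∀ n : ℤ, n ≠ 0 → fhat (fun _ => 1) n = 0 := by
    intro n hn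
    unfold fhat
    simp only [mul_one]
    have hc : (-(n * Complex.I) : ℂ) ≠ 0 := by simp [hn]
    have := integral_exp_mul_complex (a := 0) (b := 2 * Real.pi) hc
    have e : ∀ x : ℝ, Complex.exp (-(n * x * Complex.I)) = Complex.exp (-(n * Complex.I) * x) := by
      intro x; congr 1; ring
    simp_rw [e]
    rw [this]
    have : Complex.exp (-(n * Complex.I) * ((2 * Real.pi : ℝ) : ℂ)) = 1 := by
      rw [Complex.exp_eq_one_iff]
      exact ⟨-n, by push_cast; ring⟩
    rw [this]; simp
  have h3 : fhat (fun _ => 1) 0 = 1 := by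
    unfold fhat; simp
    field_simp
  have H' := hasSum_single (f := fun n : ℤ => ((r ^ n.natAbs : ℝ) : ℂ) *
    (Complex.exp (n * (0:ℝ) * Complex.I) * fhat (fun _ => 1) n)) 0 (by
      intro n hn; simp [h2 n hn])
  have := H.unique H'
  simp only [mul_one, h3] at this
  have e : ∫ s in (-Real.pi)..Real.pi, ((poisP r s : ℝ) : ℂ) =
    ((∫ s in (-Real.pi)..Real.pi, poisP r s : ℝ) : ℂ) := intervalIntegral.integral_ofReal
  rw [e] at this
  simp at this
  have h4 : (Real.pi : ℂ) ≠ 0 := by exact_mod_cast Real.pi_ne_zero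
  field_simp at this
  apply Complex.ofReal_injective
  rw [this]
  push_cast; ring

lemma poisP'_mul_nonneg {r : ℝ} (h0 : 0 ≤ r) (h1 : r < 1) {s : ℝ} (hs : s ∈ Set.Icc (-Real.pi) Real.pi) :
    0 ≤ -(s * poisP' r s) := by
  have hD := poisD_pos h0 h1 s
  unfold poisP'
  have hss : 0 ≤ s * Real.sin s := by
    rcases le_total 0 s with h | h
    · exact mul_nonneg h (Real.sin_nonneg_of_nonneg_of_le_pi h hs.2)
    · exact mul_nonneg_of_nonpos_of_nonpos h (Real.sin_nonpos_of_nonpos_of_neg_pi_le h hs.1)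
  have : -(s * (-((1 - r ^ 2) * (2 * r * Real.sin s)) / (1 - 2 * r * Real.cos s + r ^ 2) ^ 2)) =
    ((1 - r ^ 2) * (2 * r * (s * Real.sin s))) / (1 - 2 * r * Real.cos s + r ^ 2) ^ 2 := by ring
  rw [this]
  have : 0 ≤ 1 - r ^ 2 := by nlinarith
  positivity

lemma poisP'_integral {r : ℝ} (h0 : 0 ≤ r) (h1 : r < 1) :
    ∫ s in (-Real.pi)..Real.pi, -(s * poisP' r s) ≤ 2 * Real.pi := by
  have := intervalIntegral.integral_mul_deriv_eq_deriv_mul (a := -Real.pi) (b := Real.pi)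
    (u := fun s : ℝ => s) (u' := fun _ => (1 : ℝ)) (v := poisP r) (v' := poisP' r)
    (fun x _ => hasDerivAt_id x) (fun x _ => poisP_hasDerivAt h0 h1 x) (by simp)
    ((poisP'_cont h0 h1).intervalIntegrable _ _)
  rw [intervalIntegral.integral_neg, this]
  simp only [one_mul, poisP_integral h0 h1]
  have a1 := mul_nonneg Real.pi_pos.le (poisP_nonneg h0 h1 Real.pi)
  have a2 := mul_nonneg Real.pi_pos.le (poisP_nonneg h0 h1 (-Real.pi))
  linarith

lemma poisP'_far {r δ : ℝ} (h0 : 1 / 2 ≤ r) (h1 : r < 1) (hδ : 0 < δ) {s : ℝ}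
    (hs : s ∈ Set.Icc (-Real.pi) Real.pi) (hs2 : δ ≤ |s|) :
    |poisP' r s| ≤ (2 / (1 - Real.cos δ) ^ 2) * (1 - r ^ 2) := by
  have hD := poisD_pos (by linarith) h1 s
  have hspi : |s| ≤ Real.pi := abs_le.mpr hs
  have hcos : Real.cos s ≤ Real.cos δ := by
    rw [← Real.cos_abs s]
    exact Real.cos_le_cos_of_nonneg_of_le_pi hδ.le hspi hs2
  have hcd : Real.cos δ < 1 := by
    rw [← Real.cos_zero]
    exact Real.cos_lt_cos_of_nonneg_of_le_pi le_rfl (hs2.trans hspi) hδ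
  have hD2 : 1 - Real.cos δ ≤ 1 - 2 * r * Real.cos s + r ^ 2 := by
    nlinarith [sq_nonneg (1 - r)]
  have h1r : 0 ≤ 1 - r ^ 2 := by nlinarith
  unfold poisP'
  rw [abs_div, abs_neg, abs_mul, abs_of_nonneg h1r, abs_of_pos (pow_pos hD 2), div_mul_eq_mul_div]
  have hn : |2 * r * Real.sin s| ≤ 2 := by
    rw [abs_mul, abs_mul, abs_of_nonneg (by linarith : 0 ≤ r)]
    have := Real.abs_sin_le_one s
    have h3 := abs_nonneg (Real.sin s)
    norm_num
    nlinarith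
  have h2 : 0 < (1 - Real.cos δ) := by linarith
  apply div_le_div₀
  · positivity
  · nlinarith
  · positivity
  · gcongr

lemma poisP_pi {r : ℝ} (h0 : 0 ≤ r) (h1 : r < 1) : poisP r Real.pi ≤ 1 - r ^ 2 ∧ poisP r (-Real.pi) ≤ 1 - r ^ 2 := by
  have h1r : 0 ≤ 1 - r ^ 2 := by nlinarith
  have : poisP r Real.pi ≤ 1 - r ^ 2 := by
    unfold poisP; rw [Real.cos_pi]
    apply div_le_self h1r; nlinarith
  refine ⟨this, ?_⟩
  unfold poisP at *; rw [Real.cos_neg]; exact this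

lemma fatou_real (u : ℝ → ℝ) (hu : ∀ a b, IntervalIntegrable u volume a b) :
    ∀ᵐ t, Tendsto (fun r => (2 * Real.pi)⁻¹ * ∫ s in (-Real.pi)..Real.pi, poisP r s * u (t + s))
      (𝓝[<] 1) (𝓝 (u t)) := by
  have hloc : LocallyIntegrable u volume := by
    rw [locallyIntegrable_iff]
    intro k hk
    obtain ⟨a, ha⟩ := hk.bddBelow
    obtain ⟨b, hb⟩ := hk.bddAbove
    have h1 := (hu (a - 1) b).1
    exact h1.mono_set (fun x hx => ⟨by linarith [ha hx], hb hx⟩)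
  have hL := LocallyIntegrable.ae_hasDerivAt_integral hloc
  filter_upwards [hL] with t ht
  set c := u t with hc
  set g : ℝ → ℝ := fun s => u (t + s) - c with hg
  have hgi : ∀ a b, IntervalIntegrable g volume a b := by
    intro a b
    apply IntervalIntegrable.sub
    · have := (hu (a + t) (b + t)).comp_add_left t
      simpa using this
    · simp
  set E : ℝ → ℝ := fun s => ∫ x in (0)..s, g x with hE
  have hEs : ∀ s, E s = (∫ x in t..(t + s), u x) - c * s := by
    intro s
    simp only [hE, hg]
    rw [intervalIntegral.integral_sub]
    · simp [mul_comm]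
    · have := (hu (0 + t) (s + t)).comp_add_left t
      simpa using this
    · simp
  have hE0 : HasDerivAt E 0 0 := by
    have h1 : HasDerivAt (fun s => ∫ x in t..(t + s), u x) c 0 := by
      have := (ht t)
      have h2 : HasDerivAt (fun s : ℝ => t + s) 1 0 := (hasDerivAt_id 0).const_add t
      have h3 := HasDerivAt.comp (h₂ := fun x => ∫ y in t..x, u y) (h₂' := c) (0 : ℝ) (by simpa using this) h2
      simpa [Function.comp_def] using h3
    have h2 := h1.sub ((hasDerivAt_id (0:ℝ)).const_mul c)
    have : E = (fun s => ∫ x in t..(t + s), u x) - (fun s => c * id s) := by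
      funext s; simp [hEs]
    rw [this]
    exact h2.congr_deriv (by ring)
  have hEz : E 0 = 0 := by simp [hE]
  have hAC : AbsolutelyContinuousOnInterval E (-Real.pi) Real.pi := by
    apply IntervalIntegrable.absolutelyContinuousOnInterval_intervalIntegral (hgi _ _)
    rw [Set.uIcc_of_le (by linarith [Real.pi_pos])]
    constructor <;> linarith [Real.pi_pos]
  obtain ⟨M, hM⟩ := hAC.exists_bound
  rw [Set.uIcc_of_le (by linarith [Real.pi_pos])] at hM
  have hpi := Real.pi_pos
  have hM0 : 0 ≤ M := (norm_nonneg _).trans (hM 0 ⟨by linarith, by linarith⟩)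
  -- integration by parts
  have hparts : ∀ r : ℝ, 0 ≤ r → r < 1 → ∫ s in (-Real.pi)..Real.pi, poisP r s * g s =
      poisP r Real.pi * E Real.pi - poisP r (-Real.pi) * E (-Real.pi) -
        ∫ s in (-Real.pi)..Real.pi, poisP' r s * E s := by
    intro r h0 h1
    have hP : AbsolutelyContinuousOnInterval (poisP r) (-Real.pi) Real.pi :=
      (poisP_contDiff h0 h1).contDiffOn.absolutelyContinuousOnInterval
    have := hP.integral_mul_deriv_eq_deriv_mul hAC
    have hd : deriv (poisP r) = poisP' r := funext fun s => (poisP_hasDerivAt h0 h1 s).deriv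
    rw [hd] at this
    rw [← this]
    apply intervalIntegral.integral_congr_ae
    have hLg := (hgi (-Real.pi) Real.pi).ae_hasDerivAt_integral
    filter_upwards [hLg] with s hs hs'
    have := hs (Set.uIoc_subset_uIcc hs') 0 (by
      rw [Set.uIcc_of_le (by linarith)]; constructor <;> linarith)
    rw [this.deriv]
  have hmain : ∀ r : ℝ, 0 ≤ r → r < 1 →
      (2 * Real.pi)⁻¹ * (∫ s in (-Real.pi)..Real.pi, poisP r s * u (t + s)) - c =
      (2 * Real.pi)⁻¹ * ∫ s in (-Real.pi)..Real.pi, poisP r s * g s := by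
    intro r h0 h1
    have : ∫ s in (-Real.pi)..Real.pi, poisP r s * u (t + s) =
      (∫ s in (-Real.pi)..Real.pi, poisP r s * g s) + ∫ s in (-Real.pi)..Real.pi, poisP r s * c := by
      rw [← intervalIntegral.integral_add]
      · congr 1; funext s; simp only [hg]; ring
      · exact (hgi _ _).continuousOn_mul (poisP_cont h0 h1).continuousOn
      · exact ((poisP_cont h0 h1).mul continuous_const).intervalIntegrable _ _
    rw [this, intervalIntegral.integral_mul_const, poisP_integral h0 h1]
    field_simp
    ring
  rw [Metric.tendsto_nhds]
  intro ε hε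
  -- choose δ
  have hsmall : ∀ᶠ s in 𝓝 (0:ℝ), ‖E s‖ ≤ (ε / 2) * ‖s‖ := by
    have := hE0.isLittleO
    have := this.def (c := ε / 2) (by positivity)
    filter_upwards [this] with s hs
    simpa [hEz] using hs
  obtain ⟨δ, hδ, hball⟩ := Metric.eventually_nhds_iff.mp hsmall
  set C : ℝ := 2 / (1 - Real.cos δ) ^ 2 with hC
  have hC0 : 0 ≤ C := by positivity
  have hlim : Tendsto (fun r : ℝ => (2 * Real.pi)⁻¹ * (2 * M * (1 - r ^ 2) + 2 * Real.pi * (M * C * (1 - r ^ 2))))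
      (𝓝[<] 1) (𝓝 0) := by
    have : Continuous (fun r : ℝ => (2 * Real.pi)⁻¹ * (2 * M * (1 - r ^ 2) + 2 * Real.pi * (M * C * (1 - r ^ 2)))) := by
      fun_prop
    have h := this.tendsto 1
    simp only [one_pow, sub_self, mul_zero, add_zero] at h
    exact h.mono_left nhdsWithin_le_nhds
  have hev := hlim.eventually (gt_mem_nhds (show (0:ℝ) < ε / 2 by positivity))
  have hr1 : ∀ᶠ r : ℝ in 𝓝[<] 1, r < 1 := self_mem_nhdsWithin
  have hr2 : ∀ᶠ r : ℝ in 𝓝[<] 1, 1 / 2 ≤ r :=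
    nhdsWithin_le_nhds (Ici_mem_nhds (by norm_num))
  filter_upwards [hev, hr1, hr2] with r hr h1 hhalf
  have h0 : 0 ≤ r := by linarith
  rw [Real.dist_eq, hmain r h0 h1, hparts r h0 h1, abs_mul, abs_of_pos (by positivity : 0 < (2 * Real.pi)⁻¹)]
  have hinteg : |∫ s in (-Real.pi)..Real.pi, poisP' r s * E s| ≤
      (ε / 2) * (2 * Real.pi) + 2 * Real.pi * (M * C * (1 - r ^ 2)) := by
    have hcont : Continuous (fun s => (ε / 2) * (-(s * poisP' r s)) + M * C * (1 - r ^ 2)) := by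
      have := poisP'_cont h0 h1
      fun_prop
    have hb := intervalIntegral.norm_integral_le_of_norm_le (a := -Real.pi) (b := Real.pi)
      (μ := volume) (f := fun s => poisP' r s * E s)
      (g := fun s => (ε / 2) * (-(s * poisP' r s)) + M * C * (1 - r ^ 2)) (by linarith)
      (by
        filter_upwards with s hs
        have hs' : s ∈ Set.Icc (-Real.pi) Real.pi := Set.Ioc_subset_Icc_self hs
        have hnn := poisP'_mul_nonneg h0 h1 hs'
        have h1r : 0 ≤ 1 - r ^ 2 := by nlinarith
        rw [norm_mul]
        by_cases hsd : |s| < δ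
        · have hb := hball (y := s) (by simpa using hsd)
          have e : |poisP' r s| * |s| = -(s * poisP' r s) := by
            rw [← abs_mul, mul_comm, ← abs_neg, abs_of_nonneg hnn]
          have : ‖poisP' r s‖ * ‖E s‖ ≤ ‖poisP' r s‖ * (ε / 2 * ‖s‖) := by gcongr
          simp only [Real.norm_eq_abs] at *
          have e2 : |poisP' r s| * (ε / 2 * |s|) = ε / 2 * (-(s * poisP' r s)) := by
            rw [← e]; ring
          have : 0 ≤ M * C * (1 - r ^ 2) := by positivity
          linarith
        · have hf := poisP'_far hhalf h1 hδ hs' (not_lt.mp hsd)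
          have h2 : ‖poisP' r s‖ * ‖E s‖ ≤ (C * (1 - r ^ 2)) * M := by
            apply mul_le_mul hf (hM s hs') (norm_nonneg _)
            positivity
          have : 0 ≤ ε / 2 * (-(s * poisP' r s)) := by positivity
          linarith)
      (hcont.intervalIntegrable _ _)
    rw [Real.norm_eq_abs] at hb
    refine hb.trans ?_
    rw [intervalIntegral.integral_add, intervalIntegral.integral_const_mul]
    · have := poisP'_integral h0 h1
      have h3 : ε / 2 * ∫ s in (-Real.pi)..Real.pi, -(s * poisP' r s) ≤ ε / 2 * (2 * Real.pi) := by gcongr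
      simp only [intervalIntegral.integral_const, smul_eq_mul]
      linarith
    · have := poisP'_cont h0 h1
      exact Continuous.intervalIntegrable (by fun_prop) _ _
    · simp
  have hb1 : |poisP r Real.pi * E Real.pi| ≤ (1 - r ^ 2) * M := by
    rw [abs_mul, abs_of_nonneg (poisP_nonneg h0 h1 _)]
    exact mul_le_mul (poisP_pi h0 h1).1 (hM _ ⟨by linarith, le_rfl⟩) (abs_nonneg _) (by nlinarith)
  have hb2 : |poisP r (-Real.pi) * E (-Real.pi)| ≤ (1 - r ^ 2) * M := by
    rw [abs_mul, abs_of_nonneg (poisP_nonneg h0 h1 _)]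
    exact mul_le_mul (poisP_pi h0 h1).2 (hM _ ⟨le_rfl, by linarith⟩) (abs_nonneg _) (by nlinarith)
  have htot : |poisP r Real.pi * E Real.pi - poisP r (-Real.pi) * E (-Real.pi) -
        ∫ s in (-Real.pi)..Real.pi, poisP' r s * E s| ≤
      (2 * M * (1 - r ^ 2) + 2 * Real.pi * (M * C * (1 - r ^ 2))) + (ε / 2) * (2 * Real.pi) := by
    have := abs_sub (poisP r Real.pi * E Real.pi - poisP r (-Real.pi) * E (-Real.pi)) (∫ s in (-Real.pi)..Real.pi, poisP' r s * E s)
    have h' := abs_sub (poisP r Real.pi * E Real.pi) (poisP r (-Real.pi) * E (-Real.pi))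
    linarith
  calc _ ≤ (2 * Real.pi)⁻¹ * ((2 * M * (1 - r ^ 2) + 2 * Real.pi * (M * C * (1 - r ^ 2))) + (ε / 2) * (2 * Real.pi)) := by
        gcongr
    _ = (2 * Real.pi)⁻¹ * (2 * M * (1 - r ^ 2) + 2 * Real.pi * (M * C * (1 - r ^ 2))) + ε / 2 := by
        field_simp
    _ < ε := by linarith

lemma fatou_complex (u : ℝ → ℂ) (hu : ∀ a b, IntervalIntegrable u volume a b) :
    ∀ᵐ t, Tendsto (fun r : ℝ => ((2 * Real.pi : ℝ)⁻¹ : ℂ) * ∫ s in (-Real.pi)..Real.pi, (poisP r s : ℂ) * u (t + s))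
      (𝓝[<] 1) (𝓝 (u t)) := by
  have hre : ∀ a b, IntervalIntegrable (fun x => (u x).re) volume a b := fun a b =>
    ⟨(hu a b).1.re, (hu a b).2.re⟩
  have him : ∀ a b, IntervalIntegrable (fun x => (u x).im) volume a b := fun a b =>
    ⟨(hu a b).1.im, (hu a b).2.im⟩
  filter_upwards [fatou_real _ hre, fatou_real _ him] with t h1 h2
  have h1' := (Complex.continuous_ofReal.tendsto _).comp h1
  have h2' := (Complex.continuous_ofReal.tendsto _).comp h2
  have h3 := h1'.add (h2'.mul_const Complex.I)
  rw [Complex.re_add_im] at h3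
  refine h3.congr' ?_
  have hr1 : ∀ᶠ r : ℝ in 𝓝[<] 1, r < 1 := self_mem_nhdsWithin
  have hr2 : ∀ᶠ r : ℝ in 𝓝[<] 1, 1 / 2 ≤ r :=
    nhdsWithin_le_nhds (Ici_mem_nhds (by norm_num))
  filter_upwards [hr1, hr2] with r hr1 hr2
  have hut : ∀ v : ℝ → ℝ, (∀ a b, IntervalIntegrable v volume a b) →
    IntervalIntegrable (fun s => poisP r s * v (t + s)) volume (-Real.pi) Real.pi := by
    intro v hv
    have := (hv (-Real.pi + t) (Real.pi + t)).comp_add_left t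
    have h : IntervalIntegrable (fun s => v (t + s)) volume (-Real.pi) Real.pi := by simpa using this
    exact h.continuousOn_mul (poisP_cont (by linarith) hr1).continuousOn
  have e : ∫ s in (-Real.pi)..Real.pi, (poisP r s : ℂ) * u (t + s) =
    ((∫ s in (-Real.pi)..Real.pi, poisP r s * (u (t + s)).re : ℝ) : ℂ) +
    ((∫ s in (-Real.pi)..Real.pi, poisP r s * (u (t + s)).im : ℝ) : ℂ) * Complex.I := by
    rw [← intervalIntegral.integral_ofReal, ← intervalIntegral.integral_ofReal,
      ← intervalIntegral.integral_mul_const, ← intervalIntegral.integral_add]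
    · congr 1; funext s
      push_cast
      conv_lhs => rw [← Complex.re_add_im (u (t + s))]
      ring
    · have := hut _ hre
      exact ⟨this.1.ofReal, this.2.ofReal⟩
    · have := hut _ him
      exact (IntervalIntegrable.mul_const ⟨this.1.ofReal, this.2.ofReal⟩ _)
  rw [e]
  simp only [Function.comp]
  push_cast
  ring

/-- Uniqueness of Fourier coefficients for integrable periodic functions. -/
lemma fourier_unique (u : ℝ → ℂ) (hp : Function.Periodic u (2 * Real.pi))
    (hu : ∀ a b, IntervalIntegrable u volume a b) (h : ∀ n : ℤ, fhat u n = 0) :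
    ∀ᵐ t, u t = 0 := by
  filter_upwards [fatou_complex u hu] with t ht
  have : Tendsto (fun r : ℝ => (0 : ℂ)) (𝓝[<] (1:ℝ)) (𝓝 (u t)) := by
    refine ht.congr' ?_
    have hr1 : ∀ᶠ r : ℝ in 𝓝[<] 1, r < 1 := self_mem_nhdsWithin
    have hr2 : ∀ᶠ r : ℝ in 𝓝[<] 1, 1 / 2 ≤ r :=
      nhdsWithin_le_nhds (Ici_mem_nhds (by norm_num))
    filter_upwards [hr1, hr2] with r hr1 hr2
    have := pois_rep (by linarith) hr1 u hp hu t
    simp only [h, mul_zero] at this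
    have h2 := this.unique hasSum_zero
    simpa using h2
  exact tendsto_nhds_unique this tendsto_const_nhds

instance fact_two_pi : Fact (0 < 2 * Real.pi) := ⟨Real.two_pi_pos⟩

/-- `h` is the boundary function of the Hardy space function with real coefficients `x`. -/
def IsBd (x : ℕ → ℝ) (h : ℝ → ℂ) : Prop :=
  ∃ F : Lp ℂ 2 (@AddCircle.haarAddCircle (2 * Real.pi) fact_two_pi),
    (∀ t : ℝ, h t = F (t : AddCircle (2 * Real.pi))) ∧
    ∀ n : ℤ, fourierCoeff F n = if 0 ≤ n then ((x n.toNat : ℝ) : ℂ) else 0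

lemma isBd_exists (x : ℕ → ℝ) (hx : Summable fun n => (x n) ^ 2) : ∃ h, IsBd x h := by
  let c : ℤ → ℂ := fun n => if 0 ≤ n then ((x n.toNat : ℝ) : ℂ) else 0
  have hc : Memℓp c 2 := by
    rw [memℓp_gen_iff (by norm_num)]
    have hinj : Function.Injective (fun n : ℕ => (n : ℤ)) := Nat.cast_injective
    rw [← hinj.summable_iff]
    · refine hx.congr ?_
      intro n
      simp [c]
    · intro n hn
      have : ¬ 0 ≤ n := by
        intro h; exact hn ⟨n.toNat, by simp [h]⟩
      simp [c, this]
  let F := (fourierBasis (T := 2 * Real.pi)).repr.symm ⟨c, hc⟩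
  refine ⟨fun t => F (t : AddCircle (2 * Real.pi)), F, fun t => rfl, fun n => ?_⟩
  rw [← fourierBasis_repr]
  simp [F, c]

lemma IsBd.periodic {x h} (H : IsBd x h) : Function.Periodic h (2 * Real.pi) := by
  obtain ⟨F, hF, -⟩ := H
  intro t
  rw [hF, hF, AddCircle.coe_add_period]

lemma IsBd.prod_int {x y g h} (G : IsBd x g) (H : IsBd y h) (a b : ℝ) :
    IntervalIntegrable (fun t => star (g t) * h t) volume a b := by
  have hp : Function.Periodic (fun t => star (g t) * h t) (2 * Real.pi) := by
    intro t; simp only [G.periodic t, H.periodic t]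
  obtain ⟨F, hF, -⟩ := H
  obtain ⟨K, hK, -⟩ := G
  apply hp.intervalIntegrable₀ Real.two_pi_pos.ne'
  have h1 : Integrable (fun t => star (K t) * F t) (@AddCircle.haarAddCircle (2 * Real.pi) _) :=
    MemLp.integrable_mul (Lp.memLp K).star (Lp.memLp F)
  have h2 : Integrable (fun t => star (K t) * F t) (volume : Measure (AddCircle (2 * Real.pi))) := by
    rw [AddCircle.volume_eq_smul_haarAddCircle]
    exact h1.smul_measure ENNReal.ofReal_ne_top
  have h3 := (AddCircle.measurePreserving_mk (2 * Real.pi) 0).integrable_comp_of_integrable h2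
  rw [intervalIntegrable_iff, Set.uIoc_of_le Real.two_pi_pos.le]
  simp only [zero_add] at h3
  simpa only [hF, hK, IntegrableOn, Function.comp_def] using h3

lemma IsBd.intInt {x h} (H : IsBd x h) (a b : ℝ) : IntervalIntegrable h volume a b := by
  have hp := H.periodic
  obtain ⟨F, hF, -⟩ := H
  apply hp.intervalIntegrable₀ Real.two_pi_pos.ne'
  have h1 : Integrable (fun t => F t) (@AddCircle.haarAddCircle (2 * Real.pi) _) :=
    (Lp.memLp F).integrable (by norm_num)
  have h2 : Integrable (fun t => F t) (volume : Measure (AddCircle (2 * Real.pi))) := by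
    rw [AddCircle.volume_eq_smul_haarAddCircle]
    exact h1.smul_measure ENNReal.ofReal_ne_top
  have h3 := (AddCircle.measurePreserving_mk (2 * Real.pi) 0).integrable_comp_of_integrable h2
  rw [intervalIntegrable_iff, Set.uIoc_of_le Real.two_pi_pos.le]
  simp only [zero_add] at h3
  have : h = fun t : ℝ => F (t : AddCircle (2 * Real.pi)) := funext hF
  rw [this]
  simpa only [IntegrableOn, Function.comp_def] using h3

lemma fourier_two_pi (n : ℤ) (t : ℝ) :
    (fourier n (t : AddCircle (2 * Real.pi)) : ℂ) = Complex.exp (n * t * Complex.I) := by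
  rw [fourier_coe_apply]
  congr 1
  have : (Real.pi : ℂ) ≠ 0 := by exact_mod_cast Real.pi_ne_zero
  push_cast
  field_simp

lemma IsBd.fhat_eq {x h} (H : IsBd x h) (n : ℤ) :
    fhat h n = if 0 ≤ n then ((x n.toNat : ℝ) : ℂ) else 0 := by
  obtain ⟨F, hF, hn⟩ := H
  rw [← hn, fourierCoeff_eq_intervalIntegral _ _ 0, fhat]
  simp only [zero_add, fourier_two_pi, smul_eq_mul, Complex.real_smul, hF]
  congr 1
  · simp
  · congr 1; funext t; congr 2; push_cast; ring

lemma IsBd.rep {x h} (H : IsBd x h) {r : ℝ} (h0 : 0 ≤ r) (h1 : r < 1) (t : ℝ) :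
    HasSum (fun n : ℕ => ((r : ℂ) * Complex.exp (t * Complex.I)) ^ n * ((x n : ℝ) : ℂ))
      (((2 * Real.pi : ℝ)⁻¹ : ℂ) * ∫ s in (-Real.pi)..Real.pi, (poisP r s : ℂ) * h (t + s)) := by
  have := pois_rep h0 h1 h H.periodic H.intInt t
  rw [Complex.ofReal_inv] at this
  have hinj : Function.Injective (fun n : ℕ => (n : ℤ)) := Nat.cast_injective
  rw [← hinj.hasSum_iff] at this
  · refine hasSum_congr_fun ?_ this
    intro n
    simp only [Function.comp, H.fhat_eq, Int.natAbs_natCast]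
    rw [mul_pow, ← Complex.exp_nat_mul]
    simp [mul_assoc]
  · intro n hn
    have : ¬ 0 ≤ n := by
      intro h; exact hn ⟨n.toNat, by simp [h]⟩
    simp [H.fhat_eq, this]

lemma IsBd.radial {x h} (H : IsBd x h) :
    ∀ᵐ t : ℝ, Tendsto (fun r : ℝ => ∑' n : ℕ, ((r : ℂ) * Complex.exp (t * Complex.I)) ^ n * ((x n : ℝ) : ℂ))
      (𝓝[<] 1) (𝓝 (h t)) := by
  filter_upwards [fatou_complex h H.intInt] with t ht
  refine ht.congr' ?_
  have hr1 : ∀ᶠ r : ℝ in 𝓝[<] 1, r < 1 := self_mem_nhdsWithin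
  have hr2 : ∀ᶠ r : ℝ in 𝓝[<] 1, 1 / 2 ≤ r :=
    nhdsWithin_le_nhds (Ici_mem_nhds (by norm_num))
  filter_upwards [hr1, hr2] with r hr1 hr2
  exact (H.rep (by linarith) hr1 t).tsum_eq.symm

lemma IsBd.parseval {x y g h} (G : IsBd x g) (H : IsBd y h) (k : ℕ) :
    HasSum (fun n : ℕ => ((x (n + k) * y n : ℝ) : ℂ))
      (((2 * Real.pi : ℝ)⁻¹ : ℂ) *
        ∫ t in (0)..(2 * Real.pi), Complex.exp (k * t * Complex.I) * (star (g t) * h t)) := by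
  obtain ⟨F, hF, hFn⟩ := H
  obtain ⟨K, hK, hKn⟩ := G
  let e : AddCircle (2 * Real.pi) → ℂ := fun t => fourier (k : ℤ) t
  have hE : MemLp (fun t => e t * F t) 2 (@AddCircle.haarAddCircle (2 * Real.pi) _) := by
    refine MemLp.of_le_mul (c := 1) (Lp.memLp F) ?_ ?_
    · exact ((fourier (k : ℤ)).continuous.aestronglyMeasurable).mul (Lp.memLp F).1
    · refine Eventually.of_forall fun t => ?_
      have : ‖e t‖ = 1 := by
        simp only [e, fourier_apply]; exact Circle.norm_coe _
      simp [this]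
  let E := hE.toLp
  have hEe := hE.coeFn_toLp
  have hEn : ∀ n : ℤ, fourierCoeff E n = fourierCoeff F (n - k) := by
    intro n
    rw [fourierCoeff_congr_ae hEe]
    unfold fourierCoeff
    congr 1; funext t
    simp only [e, smul_eq_mul]
    rw [← mul_assoc, ← fourier_add]
    congr 3; ring
  have hs := (fourierBasis (T := 2 * Real.pi)).hasSum_inner_mul_inner K E
  have e1 : inner ℂ K E = ((2 * Real.pi : ℝ)⁻¹ : ℂ) *
        ∫ t in (0)..(2 * Real.pi), Complex.exp (k * t * Complex.I) * (star (g t) * h t) := by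
    rw [L2.inner_def]
    have : ∫ a, inner ℂ (K a) (E a) ∂(@AddCircle.haarAddCircle (2 * Real.pi) _) =
      ∫ a, e a * (star (K a) * F a) ∂(@AddCircle.haarAddCircle (2 * Real.pi) _) := by
      apply integral_congr_ae
      filter_upwards [hEe] with t ht
      rw [show E t = e t * F t from ht]
      simp only [RCLike.inner_apply']
      simp; ring
    rw [this, AddCircle.integral_haarAddCircle, ← AddCircle.intervalIntegral_preimage (2 * Real.pi) 0]
    simp only [zero_add, e, fourier_two_pi, hF, hK, Complex.real_smul]
    simp
  rw [e1] at hs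
  have hinj : Function.Injective (fun n : ℕ => ((n + k : ℕ) : ℤ)) := by
    intro a b hab; simpa using hab
  rw [← hinj.hasSum_iff] at hs
  · refine hasSum_congr_fun ?_ hs
    intro n
    simp only [Function.comp]
    rw [← HilbertBasis.repr_apply_apply, ← inner_conj_symm, ← HilbertBasis.repr_apply_apply,
      fourierBasis_repr, fourierBasis_repr, hEn, hKn, hFn]
    have h1 : (0 : ℤ) ≤ ((n + k : ℕ) : ℤ) := Int.natCast_nonneg _
    have h2 : ((n + k : ℕ) : ℤ) - (k : ℤ) = (n : ℤ) := by push_cast; ring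
    rw [h2, if_pos h1, if_pos (Int.natCast_nonneg _), Int.toNat_natCast, Int.toNat_natCast,
      Complex.conj_ofReal]
    push_cast; rfl
  · intro n hn
    rw [← HilbertBasis.repr_apply_apply, ← inner_conj_symm, ← HilbertBasis.repr_apply_apply,
      fourierBasis_repr, fourierBasis_repr, hEn, hKn, hFn]
    have : ¬ 0 ≤ n - k := by
      intro h; exact hn ⟨(n - k).toNat, by dsimp only; omega⟩
    rw [if_neg this, mul_zero]

/-- Standard basis of the quaternions. -/
noncomputable def bq : Fin 4 → Quaternion ℝ := ![⟨1, 0, 0, 0⟩, ⟨0, 1, 0, 0⟩, ⟨0, 0, 1, 0⟩, ⟨0, 0, 0, 1⟩]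

/-- Real components of a quaternion. -/
noncomputable def cq (q : Quaternion ℝ) : Fin 4 → ℝ := ![q.re, q.imI, q.imJ, q.imK]

@[simp] lemma bq_re (l : Fin 4) : (bq l).re = (![1, 0, 0, 0] : Fin 4 → ℝ) l := by fin_cases l <;> rfl
@[simp] lemma bq_imI (l : Fin 4) : (bq l).imI = (![0, 1, 0, 0] : Fin 4 → ℝ) l := by fin_cases l <;> rfl
@[simp] lemma bq_imJ (l : Fin 4) : (bq l).imJ = (![0, 0, 1, 0] : Fin 4 → ℝ) l := by fin_cases l <;> rfl
@[simp] lemma bq_imK (l : Fin 4) : (bq l).imK = (![0, 0, 0, 1] : Fin 4 → ℝ) l := by fin_cases l <;> rfl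

lemma q1_re : QuaternionAlgebra.re (1 : Quaternion ℝ) = 1 := rfl
lemma q1_imI : QuaternionAlgebra.imI (1 : Quaternion ℝ) = 0 := rfl
lemma q1_imJ : QuaternionAlgebra.imJ (1 : Quaternion ℝ) = 0 := rfl
lemma q1_imK : QuaternionAlgebra.imK (1 : Quaternion ℝ) = 0 := rfl

lemma cq_sum (q : Quaternion ℝ) : ∑ l, cq q l • bq l = q := by
  rw [Fin.sum_univ_four]
  ext <;> simp [cq]

/-- The embedding of the complex plane onto a slice. -/
noncomputable def phi (I : Quaternion ℝ) (z : ℂ) : Quaternion ℝ := (z.re : Quaternion ℝ) + z.im • I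

lemma USphere_sq {I : Quaternion ℝ} (hI : I ∈ USphere) : I * I = -1 := by
  have : I ^ 2 = -1 := hI
  rw [← this, sq]

lemma USphere_re {I : Quaternion ℝ} (hI : I ∈ USphere) : I.re = 0 := by
  have h := USphere_sq hI
  have h0 := congrArg QuaternionAlgebra.re h
  have h1 := congrArg QuaternionAlgebra.imI h
  have h2 := congrArg QuaternionAlgebra.imJ h
  have h3 := congrArg QuaternionAlgebra.imK h
  simp [q1_re, q1_imI, q1_imJ, q1_imK] at h0 h1 h2 h3
  by_contra hne
  have e1 : I.imI = 0 := by
    have : I.re * I.imI = 0 := by linarith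
    simpa [hne] using this
  have e2 : I.imJ = 0 := by
    have : I.re * I.imJ = 0 := by linarith
    simpa [hne] using this
  have e3 : I.imK = 0 := by
    have : I.re * I.imK = 0 := by linarith
    simpa [hne] using this
  rw [e1, e2, e3] at h0
  nlinarith [sq_nonneg I.re]

lemma USphere_im {I : Quaternion ℝ} (hI : I ∈ USphere) : I.imI ^ 2 + I.imJ ^ 2 + I.imK ^ 2 = 1 := by
  have h := USphere_sq hI
  have h0 := congrArg QuaternionAlgebra.re h
  have hr := USphere_re hI
  simp [hr, q1_re] at h0
  nlinarith

lemma mem_USphere_iff {I : Quaternion ℝ} :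
    I ∈ USphere ↔ I.re = 0 ∧ I.imI ^ 2 + I.imJ ^ 2 + I.imK ^ 2 = 1 := by
  refine ⟨fun h => ⟨USphere_re h, USphere_im h⟩, fun ⟨h0, h1⟩ => ?_⟩
  show I ^ 2 = -1
  rw [sq]
  ext <;> simp [h0, q1_re, q1_imI, q1_imJ, q1_imK] <;> nlinarith

lemma phi_eq {I : Quaternion ℝ} (hI : I ∈ USphere) (z : ℂ) :
    phi I z = Complex.liftAux I (USphere_sq hI) z := by
  rw [Complex.liftAux_apply]; rfl

/-- `phi` as a continuous linear map. -/
noncomputable def phiL (I : Quaternion ℝ) (hI : I ∈ USphere) : ℂ →L[ℝ] Quaternion ℝ :=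
  LinearMap.toContinuousLinearMap (Complex.liftAux I (USphere_sq hI)).toLinearMap

lemma phiL_apply {I : Quaternion ℝ} (hI : I ∈ USphere) (z : ℂ) : phiL I hI z = phi I z := by
  rw [phi_eq hI]; rfl

lemma phi_mul {I : Quaternion ℝ} (hI : I ∈ USphere) (z w : ℂ) : phi I (z * w) = phi I z * phi I w := by
  simp only [phi_eq hI, map_mul]

lemma phi_pow {I : Quaternion ℝ} (hI : I ∈ USphere) (z : ℂ) (n : ℕ) : phi I (z ^ n) = phi I z ^ n := by
  simp only [phi_eq hI, map_pow]

lemma phi_ofReal (I : Quaternion ℝ) (x : ℝ) : phi I (x : ℂ) = (x : Quaternion ℝ) := by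
  simp [phi]

lemma phi_star {I : Quaternion ℝ} (hI : I ∈ USphere) (z : ℂ) : star (phi I z) = phi I (star z) := by
  have := USphere_re hI
  unfold phi
  ext <;> simp [this]

lemma phi_exp (I : Quaternion ℝ) (t : ℝ) : phi I (Complex.exp (t * Complex.I)) = ptOn I t := by
  unfold phi ptOn
  rw [Complex.exp_ofReal_mul_I_re, Complex.exp_ofReal_mul_I_im]

/-- The map `z ↦ p * phi I z * q` as a continuous linear map. -/
noncomputable def psiL (I : Quaternion ℝ) (hI : I ∈ USphere) (p q : Quaternion ℝ) : ℂ →L[ℝ] Quaternion ℝ :=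
  (ContinuousLinearMap.mul ℝ (Quaternion ℝ) p).comp
    (((ContinuousLinearMap.mul ℝ (Quaternion ℝ)).flip q).comp (phiL I hI))

lemma psiL_apply {I : Quaternion ℝ} (hI : I ∈ USphere) (p q : Quaternion ℝ) (z : ℂ) :
    psiL I hI p q z = p * (phi I z * q) := by
  simp [psiL, phiL_apply]

/-- The family of boundary functions of the four real components. -/
def IsBd4 (a : ℕ → Quaternion ℝ) (H : Fin 4 → ℝ → ℂ) : Prop :=
  ∀ l, IsBd (fun n => cq (a n) l) (H l)

lemma cq_sq (q : Quaternion ℝ) (l : Fin 4) : (cq q l) ^ 2 ≤ ‖q‖ ^ 2 := by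
  have : ‖q‖ ^ 2 = q.re ^ 2 + q.imI ^ 2 + q.imJ ^ 2 + q.imK ^ 2 := by
    rw [← Quaternion.normSq_def', Quaternion.normSq_eq_norm_mul_self, sq]
  rw [this]
  fin_cases l <;> simp [cq] <;> nlinarith [sq_nonneg q.re, sq_nonneg q.imI, sq_nonneg q.imJ, sq_nonneg q.imK]

lemma isBd4_exists (a : ℕ → Quaternion ℝ) (ha : MemH2 a) : ∃ H, IsBd4 a H := by
  have : ∀ l : Fin 4, ∃ h, IsBd (fun n => cq (a n) l) h := fun l => isBd_exists _
    (Summable.of_nonneg_of_le (fun n => sq_nonneg _) (fun n => cq_sq _ _) ha)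
  choose H hH using this
  exact ⟨H, hH⟩

/-- The boundary value on the slice `I`. -/
noncomputable def fst4 (H : Fin 4 → ℝ → ℂ) (I : Quaternion ℝ) (t : ℝ) : Quaternion ℝ :=
  ∑ l, phi I (H l t) * bq l

lemma evalS_phi {a : ℕ → Quaternion ℝ} {I : Quaternion ℝ} (hI : I ∈ USphere) (z : ℂ) (w : Fin 4 → ℂ)
    (hw : ∀ l, HasSum (fun n : ℕ => z ^ n * ((cq (a n) l : ℝ) : ℂ)) (w l)) :
    evalS a (phi I z) = ∑ l, phi I (w l) * bq l := by
  have h : HasSum (fun n => ∑ l, phi I (z ^ n * ((cq (a n) l : ℝ) : ℂ)) * bq l) (∑ l, phi I (w l) * bq l) := by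
    apply hasSum_sum
    intro l _
    apply HasSum.mul_right
    have := (phiL I hI).hasSum (hw l)
    simpa only [phiL_apply] using this
  have e : (fun n => ∑ l, phi I (z ^ n * ((cq (a n) l : ℝ) : ℂ)) * bq l) = fun n => phi I z ^ n * a n := by
    funext n
    conv_rhs => rw [← cq_sum (a n)]
    rw [Finset.mul_sum]
    apply Finset.sum_congr rfl
    intro l _
    rw [phi_mul hI, phi_pow hI, phi_ofReal, mul_assoc, Quaternion.coe_mul_eq_smul]
  rw [e] at h
  exact h.tsum_eq

lemma real_mul_ptOn {I : Quaternion ℝ} (hI : I ∈ USphere) (r t : ℝ) :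
    (r : Quaternion ℝ) * ptOn I t = phi I ((r : ℂ) * Complex.exp (t * Complex.I)) := by
  rw [phi_mul hI, phi_ofReal, phi_exp]

lemma bd_good {a : ℕ → Quaternion ℝ} {H : Fin 4 → ℝ → ℂ} (hH : IsBd4 a H) :
    ∀ᵐ t : ℝ, ∀ I ∈ USphere, bdval a (ptOn I t) = fst4 H I t := by
  have h := ae_all_iff.mpr fun l => (hH l).radial
  filter_upwards [h] with t ht I hI
  have key : Tendsto (fun r : ℝ => evalS a ((r : Quaternion ℝ) * ptOn I t)) (𝓝[<] (1 : ℝ)) (𝓝 (fst4 H I t)) := by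
    have h1 : Tendsto (fun r : ℝ => ∑ l, phi I (∑' n : ℕ, ((r : ℂ) * Complex.exp (t * Complex.I)) ^ n * ((cq (a n) l : ℝ) : ℂ)) * bq l)
      (𝓝[<] (1 : ℝ)) (𝓝 (fst4 H I t)) := by
      apply tendsto_finsetSum
      intro l _
      apply Tendsto.mul_const
      have := ((phiL I hI).continuous.tendsto (H l t)).comp (ht l)
      simpa only [Function.comp_def, phiL_apply] using this
    refine h1.congr' ?_
    have hr1 : ∀ᶠ r : ℝ in 𝓝[<] 1, r < 1 := self_mem_nhdsWithin
    have hr2 : ∀ᶠ r : ℝ in 𝓝[<] 1, 1 / 2 ≤ r :=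
      nhdsWithin_le_nhds (Ici_mem_nhds (by norm_num))
    filter_upwards [hr1, hr2] with r hr1 hr2
    rw [real_mul_ptOn hI, evalS_phi hI]
    intro l
    exact ((hH l).rep (by linarith) hr1 t).summable.hasSum
  have hex : ∃ L, Tendsto (fun r : ℝ => evalS a ((r : Quaternion ℝ) * ptOn I t)) (𝓝[<] (1 : ℝ)) (𝓝 L) := ⟨_, key⟩
  unfold bdval
  rw [dif_pos hex]
  exact tendsto_nhds_unique hex.choose_spec key

lemma fst4_int {a : ℕ → Quaternion ℝ} {H : Fin 4 → ℝ → ℂ} (hH : IsBd4 a H) {I : Quaternion ℝ}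
    (hI : I ∈ USphere) (u v : ℝ) : IntervalIntegrable (fst4 H I) volume u v := by
  have : ∀ l : Fin 4, IntervalIntegrable (fun t => phi I (H l t) * bq l) volume u v := by
    intro l
    apply IntervalIntegrable.mul_const
    have h := (hH l).intInt u v
    have h1 := (phiL I hI).integrable_comp h.1
    have h2 := (phiL I hI).integrable_comp h.2
    simp only [phiL_apply] at h1 h2
    exact ⟨h1, h2⟩
  unfold fst4
  simp only [Fin.sum_univ_four]
  exact (((this 0).add (this 1)).add (this 2)).add (this 3)

lemma evalS_pois {a : ℕ → Quaternion ℝ} {H : Fin 4 → ℝ → ℂ} (hH : IsBd4 a H) {I : Quaternion ℝ}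
    (hI : I ∈ USphere) {r : ℝ} (h0 : 0 ≤ r) (h1 : r < 1) (t : ℝ) :
    evalS a ((r : Quaternion ℝ) * ptOn I t) =
      (2 * Real.pi)⁻¹ • ∫ s in (-Real.pi)..Real.pi, poisP r s • fst4 H I (t + s) := by
  rw [real_mul_ptOn hI, evalS_phi hI _ _ (fun l => (hH l).rep h0 h1 t)]
  have hinteg : ∀ l, IntervalIntegrable (fun s => (poisP r s : ℂ) * H l (t + s)) volume (-Real.pi) Real.pi := by
    intro l
    have := ((hH l).intInt (-Real.pi + t) (Real.pi + t)).comp_add_left t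
    have h : IntervalIntegrable (fun s => H l (t + s)) volume (-Real.pi) Real.pi := by simpa using this
    exact h.continuousOn_mul (Complex.continuous_ofReal.comp (poisP_cont h0 h1)).continuousOn
  have hpi := Real.pi_pos
  have e : ∀ s, poisP r s • fst4 H I (t + s) = ∑ l, phi I ((poisP r s : ℂ) * H l (t + s)) * bq l := by
    intro s
    unfold fst4
    rw [Finset.smul_sum]
    apply Finset.sum_congr rfl
    intro l _
    rw [phi_mul hI, phi_ofReal, mul_assoc, Quaternion.coe_mul_eq_smul]
  simp only [e]
  have hinteg2 : ∀ l, IntervalIntegrable (fun s => phi I ((poisP r s : ℂ) * H l (t + s)) * bq l) volume (-Real.pi) Real.pi := by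
    intro l
    apply IntervalIntegrable.mul_const
    have h1 := (phiL I hI).integrable_comp (hinteg l).1
    have h2 := (phiL I hI).integrable_comp (hinteg l).2
    simp only [phiL_apply] at h1 h2
    exact ⟨h1, h2⟩
  rw [intervalIntegral.integral_finsetSum (fun l _ => hinteg2 l), Finset.smul_sum]
  apply Finset.sum_congr rfl
  intro l _
  have := (psiL I hI 1 (bq l)).intervalIntegral_comp_comm (hinteg l)
  simp only [psiL_apply, one_mul] at this
  rw [this, phi_mul hI]
  rw [← Complex.ofReal_inv, phi_ofReal, mul_assoc, Quaternion.coe_mul_eq_smul]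

lemma h2inner_shift (a : ℕ → Quaternion ℝ) (k : ℕ) :
    h2inner (sProd (qpow k) a) a = ∑' n, star (a (n + k)) * a n := by
  have hs : ∀ n, sProd (qpow k) a n = if k ≤ n then a (n - k) else 0 := by
    intro n
    unfold sProd qpow
    simp only [ite_mul, one_mul, zero_mul]
    rw [Finset.sum_ite_eq']
    simp only [Finset.mem_range, Nat.lt_succ_iff]
  unfold h2inner
  simp only [hs]
  have hinj : Function.Injective (fun n : ℕ => n + k) := add_left_injective k
  rw [← hinj.tsum_eq]
  · simp
  · intro n hn
    have : k ≤ n := by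
      by_contra h
      simp [h] at hn
    exact ⟨n - k, by simp [this]⟩

/-- Real moments. -/
noncomputable def cc (a : ℕ → Quaternion ℝ) (k : ℕ) (l m : Fin 4) : ℝ :=
  ∑' n, cq (a (n + k)) l * cq (a n) m

/-- The quaternionic moment. -/
noncomputable def QQ (a : ℕ → Quaternion ℝ) (k : ℕ) : Quaternion ℝ :=
  ∑ l, ∑ m, cc a k l m • (star (bq l) * bq m)

lemma cc_hasSum {a : ℕ → Quaternion ℝ} {H : Fin 4 → ℝ → ℂ} (hH : IsBd4 a H) (k : ℕ) (l m : Fin 4) :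
    HasSum (fun n => cq (a (n + k)) l * cq (a n) m) (cc a k l m) := by
  have := ((hH l).parseval (hH m) k).summable
  rw [Complex.summable_ofReal] at this
  exact this.hasSum

lemma cc_eq {a : ℕ → Quaternion ℝ} {H : Fin 4 → ℝ → ℂ} (hH : IsBd4 a H) (k : ℕ) (l m : Fin 4) :
    ((cc a k l m : ℝ) : ℂ) = ((2 * Real.pi : ℝ)⁻¹ : ℂ) *
        ∫ t in (0)..(2 * Real.pi), Complex.exp (k * t * Complex.I) * (star (H l t) * H m t) := by
  have h1 := (hH l).parseval (hH m) k
  have h2 := Complex.hasSum_ofReal.mpr (cc_hasSum hH k l m)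
  exact h2.unique h1

lemma moment_eq {a : ℕ → Quaternion ℝ} {H : Fin 4 → ℝ → ℂ} (hH : IsBd4 a H) (k : ℕ) :
    h2inner (sProd (qpow k) a) a = QQ a k := by
  rw [h2inner_shift]
  have h : HasSum (fun n => ∑ l, ∑ m, (cq (a (n + k)) l * cq (a n) m) • (star (bq l) * bq m)) (QQ a k) := by
    apply hasSum_sum; intro l _
    apply hasSum_sum; intro m _
    exact (cc_hasSum hH k l m).smul_const _
  rw [← h.tsum_eq]
  congr 1; funext n
  conv_lhs => rw [← cq_sum (a (n + k)), ← cq_sum (a n), star_sum, Finset.sum_mul]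
  apply Finset.sum_congr rfl; intro l _
  rw [Finset.mul_sum]
  apply Finset.sum_congr rfl; intro m _
  rw [Quaternion.star_smul, smul_mul_smul_comm]

lemma slice_eq {a : ℕ → Quaternion ℝ} {H : Fin 4 → ℝ → ℂ} (hH : IsBd4 a H) {I : Quaternion ℝ}
    (hI : I ∈ USphere) (k : ℕ) : sliceInnerPow a I k = QQ a k := by
  unfold sliceInnerPow
  have hpi := Real.two_pi_pos
  rw [integral_Ico_eq_integral_Ioc, ← intervalIntegral.integral_of_le hpi.le]
  have e1 : ∫ t in (0)..(2 * Real.pi), star (bdval a (ptOn I t)) * ((ptOn I t) ^ k * bdval a (ptOn I t)) =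
    ∫ t in (0)..(2 * Real.pi), ∑ l, ∑ m, psiL I hI (star (bq l)) (bq m)
      (Complex.exp (k * t * Complex.I) * (star (H l t) * H m t)) := by
    apply intervalIntegral.integral_congr_ae
    filter_upwards [bd_good hH] with t ht _
    rw [ht I hI]
    unfold fst4
    rw [star_sum, Finset.sum_mul]
    apply Finset.sum_congr rfl; intro l _
    rw [Finset.mul_sum, Finset.mul_sum]
    apply Finset.sum_congr rfl; intro m _
    rw [psiL_apply, star_mul, phi_star hI, ← phi_exp, ← phi_pow hI, ← Complex.exp_nat_mul]
    have : Complex.exp (k * t * Complex.I) * (star (H l t) * H m t) =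
      star (H l t) * Complex.exp (k * (t * Complex.I)) * H m t := by
      rw [mul_assoc (k : ℂ)]; ring
    rw [this, phi_mul hI, phi_mul hI]
    simp only [mul_assoc]
  rw [e1]
  have hinteg : ∀ l m, IntervalIntegrable (fun t : ℝ => Complex.exp (k * t * Complex.I) * (star (H l t) * H m t))
      volume 0 (2 * Real.pi) := by
    intro l m
    apply ((hH l).prod_int (hH m) 0 (2 * Real.pi)).continuousOn_mul
    exact Continuous.continuousOn (by fun_prop)
  have hinteg2 : ∀ l m, IntervalIntegrable (fun t : ℝ => psiL I hI (star (bq l)) (bq m)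
      (Complex.exp (k * t * Complex.I) * (star (H l t) * H m t)))
      volume 0 (2 * Real.pi) := by
    intro l m
    exact ⟨(psiL I hI (star (bq l)) (bq m)).integrable_comp (hinteg l m).1,
      (psiL I hI (star (bq l)) (bq m)).integrable_comp (hinteg l m).2⟩
  have hinteg3 : ∀ l, IntervalIntegrable (fun t : ℝ => ∑ m, psiL I hI (star (bq l)) (bq m)
      (Complex.exp (k * t * Complex.I) * (star (H l t) * H m t)))
      volume 0 (2 * Real.pi) := by
    intro l
    simp only [Fin.sum_univ_four]
    exact (((hinteg2 l 0).add (hinteg2 l 1)).add (hinteg2 l 2)).add (hinteg2 l 3)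
  rw [intervalIntegral.integral_finsetSum (fun l _ => hinteg3 l), Finset.smul_sum]
  apply Finset.sum_congr rfl; intro l _
  rw [intervalIntegral.integral_finsetSum (fun m _ => hinteg2 l m), Finset.smul_sum]
  apply Finset.sum_congr rfl; intro m _
  rw [(psiL I hI (star (bq l)) (bq m)).intervalIntegral_comp_comm (hinteg l m), ← map_smul,
    Complex.real_smul, Complex.ofReal_inv, ← cc_eq hH, psiL_apply, phi_ofReal,
    Quaternion.coe_mul_eq_smul, mul_smul_comm]

/-- The densities of the moments. -/
noncomputable def VV (H : Fin 4 → ℝ → ℂ) (j : Fin 4) (t : ℝ) : ℂ :=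
  ∑ l, ∑ m, ((cq (star (bq l) * bq m) j : ℝ) : ℂ) * (star (H l t) * H m t)

lemma VV_int {a : ℕ → Quaternion ℝ} {H : Fin 4 → ℝ → ℂ} (hH : IsBd4 a H) (j : Fin 4) (u v : ℝ) :
    IntervalIntegrable (VV H j) volume u v := by
  have hinteg2 : ∀ l m, IntervalIntegrable (fun t : ℝ => ((cq (star (bq l) * bq m) j : ℝ) : ℂ) * (star (H l t) * H m t))
      volume u v := fun l m => ((hH l).prod_int (hH m) u v).const_mul _
  unfold VV
  have hinteg3 : ∀ l, IntervalIntegrable (fun t : ℝ => ∑ m, ((cq (star (bq l) * bq m) j : ℝ) : ℂ) * (star (H l t) * H m t))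
      volume u v := by
    intro l
    simp only [Fin.sum_univ_four]
    exact (((hinteg2 l 0).add (hinteg2 l 1)).add (hinteg2 l 2)).add (hinteg2 l 3)
  simp only [Fin.sum_univ_four (f := fun l => ∑ m, _)]
  exact (((hinteg3 0).add (hinteg3 1)).add (hinteg3 2)).add (hinteg3 3)

lemma VV_per {a : ℕ → Quaternion ℝ} {H : Fin 4 → ℝ → ℂ} (hH : IsBd4 a H) (j : Fin 4) :
    Function.Periodic (VV H j) (2 * Real.pi) := by
  intro t
  unfold VV
  simp only [(hH _).periodic t]

lemma cq_QQ (a : ℕ → Quaternion ℝ) (k : ℕ) (j : Fin 4) :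
    cq (QQ a k) j = ∑ l, ∑ m, cq (star (bq l) * bq m) j * cc a k l m := by
  have hadd : ∀ p q : Quaternion ℝ, cq (p + q) j = cq p j + cq q j := by
    intro p q; fin_cases j <;> simp [cq]
  have hz : cq 0 j = 0 := by fin_cases j <;> rfl
  have hsm : ∀ (c : ℝ) (q : Quaternion ℝ), cq (c • q) j = cq q j * c := by
    intro p q; fin_cases j <;> simp [cq, mul_comm]
  let f : Quaternion ℝ →+ ℝ := ⟨⟨fun q => cq q j, hz⟩, hadd⟩
  have hf : ∀ q, cq q j = f q := fun q => rfl
  rw [hf, QQ, map_sum]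
  apply Finset.sum_congr rfl; intro l _
  rw [map_sum]
  apply Finset.sum_congr rfl; intro m _
  exact hsm _ _

lemma fhat_VV {a : ℕ → Quaternion ℝ} {H : Fin 4 → ℝ → ℂ} (hH : IsBd4 a H) (j : Fin 4) (k : ℕ) :
    fhat (VV H j) (-(k : ℤ)) = ((cq (QQ a k) j : ℝ) : ℂ) := by
  rw [cq_QQ]
  unfold fhat VV
  have hinteg2 : ∀ l m, IntervalIntegrable (fun t : ℝ => ((cq (star (bq l) * bq m) j : ℝ) : ℂ) *
      (Complex.exp (k * t * Complex.I) * (star (H l t) * H m t)))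
      volume 0 (2 * Real.pi) := by
    intro l m
    apply IntervalIntegrable.const_mul
    apply ((hH l).prod_int (hH m) 0 (2 * Real.pi)).continuousOn_mul
    exact Continuous.continuousOn (by fun_prop)
  have hinteg3 : ∀ l, IntervalIntegrable (fun t : ℝ => ∑ m, ((cq (star (bq l) * bq m) j : ℝ) : ℂ) *
      (Complex.exp (k * t * Complex.I) * (star (H l t) * H m t)))
      volume 0 (2 * Real.pi) := by
    intro l
    simp only [Fin.sum_univ_four]
    exact (((hinteg2 l 0).add (hinteg2 l 1)).add (hinteg2 l 2)).add (hinteg2 l 3)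
  have e : ∀ t : ℝ, Complex.exp (-(((-(k : ℤ) : ℤ) : ℂ) * t * Complex.I)) *
      (∑ l, ∑ m, ((cq (star (bq l) * bq m) j : ℝ) : ℂ) * (star (H l t) * H m t)) =
      ∑ l, ∑ m, ((cq (star (bq l) * bq m) j : ℝ) : ℂ) *
        (Complex.exp (k * t * Complex.I) * (star (H l t) * H m t)) := by
    intro t
    rw [Finset.mul_sum]
    apply Finset.sum_congr rfl; intro l _
    rw [Finset.mul_sum]
    apply Finset.sum_congr rfl; intro m _
    push_cast
    rw [show -(-(k:ℂ) * t * Complex.I) = k * t * Complex.I by ring]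
    ring
  simp only [e]
  rw [intervalIntegral.integral_finsetSum (fun l _ => hinteg3 l), Finset.mul_sum]
  push_cast
  apply Finset.sum_congr rfl; intro l _
  rw [intervalIntegral.integral_finsetSum (fun m _ => hinteg2 l m), Finset.mul_sum]
  apply Finset.sum_congr rfl; intro m _
  rw [intervalIntegral.integral_const_mul, cc_eq hH]
  push_cast
  ring

/-- Real part vector. -/
noncomputable def alp (H : Fin 4 → ℝ → ℂ) (t : ℝ) : Quaternion ℝ :=
  ⟨(H 0 t).re, (H 1 t).re, (H 2 t).re, (H 3 t).re⟩

/-- Imaginary part vector. -/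
noncomputable def bet (H : Fin 4 → ℝ → ℂ) (t : ℝ) : Quaternion ℝ :=
  ⟨(H 0 t).im, (H 1 t).im, (H 2 t).im, (H 3 t).im⟩

@[simp] lemma alp_re (H : Fin 4 → ℝ → ℂ) (t : ℝ) : (alp H t).re = (H 0 t).re := rfl
@[simp] lemma alp_imI (H : Fin 4 → ℝ → ℂ) (t : ℝ) : (alp H t).imI = (H 1 t).re := rfl
@[simp] lemma alp_imJ (H : Fin 4 → ℝ → ℂ) (t : ℝ) : (alp H t).imJ = (H 2 t).re := rfl
@[simp] lemma alp_imK (H : Fin 4 → ℝ → ℂ) (t : ℝ) : (alp H t).imK = (H 3 t).re := rfl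
@[simp] lemma bet_re (H : Fin 4 → ℝ → ℂ) (t : ℝ) : (bet H t).re = (H 0 t).im := rfl
@[simp] lemma bet_imI (H : Fin 4 → ℝ → ℂ) (t : ℝ) : (bet H t).imI = (H 1 t).im := rfl
@[simp] lemma bet_imJ (H : Fin 4 → ℝ → ℂ) (t : ℝ) : (bet H t).imJ = (H 2 t).im := rfl
@[simp] lemma bet_imK (H : Fin 4 → ℝ → ℂ) (t : ℝ) : (bet H t).imK = (H 3 t).im := rfl

lemma fst4_eq (H : Fin 4 → ℝ → ℂ) (I : Quaternion ℝ) (t : ℝ) :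
    fst4 H I t = alp H t + I * bet H t := by
  unfold fst4 phi
  rw [Fin.sum_univ_four]
  ext <;> simp <;> ring

lemma VV_zero (H : Fin 4 → ℝ → ℂ) (t : ℝ) : VV H 0 t =
    ((Quaternion.normSq (alp H t) + Quaternion.normSq (bet H t) : ℝ) : ℂ) := by
  unfold VV
  simp only [Fin.sum_univ_four, Quaternion.normSq_def']
  apply Complex.ext
  · rw [Complex.ofReal_re]; simp [cq]; ring
  · rw [Complex.ofReal_im]; simp [cq]; ring

lemma VV_pos (H : Fin 4 → ℝ → ℂ) (t : ℝ) (j : Fin 4) (hj : j ≠ 0) : VV H j t =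
    ((2 * cq (star (alp H t) * bet H t) j : ℝ) : ℂ) * Complex.I := by
  unfold VV
  simp only [Fin.sum_univ_four]
  fin_cases j
  · exact absurd rfl hj
  all_goals
    apply Complex.ext
    · simp [cq]; ring
    · simp [cq]; ring

/-- The pointwise condition characterizing inner functions. -/
def XX (H : Fin 4 → ℝ → ℂ) (t : ℝ) : Prop :=
  Quaternion.normSq (alp H t) + Quaternion.normSq (bet H t) = 1 ∧
    ∀ j : Fin 4, j ≠ 0 → cq (star (alp H t) * bet H t) j = 0

lemma XX_iff (H : Fin 4 → ℝ → ℂ) (t : ℝ) : XX H t ↔ ∀ j, VV H j t = if j = 0 then 1 else 0 := by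
  unfold XX
  constructor
  · rintro ⟨h0, h1⟩ j
    by_cases hj : j = 0
    · subst hj; rw [VV_zero, h0]; simp
    · rw [VV_pos _ _ _ hj, h1 j hj]; simp [hj]
  · intro h
    refine ⟨?_, fun j hj => ?_⟩
    · have := h 0
      rw [VV_zero] at this
      simp only [if_true] at this
      exact_mod_cast this
    · have := h j
      rw [VV_pos _ _ _ hj, if_neg hj] at this
      simp only [mul_eq_zero, Complex.I_ne_zero, or_false, Complex.ofReal_eq_zero] at this
      simpa using this

lemma norm_alg (p q I : Quaternion ℝ) (hI : I ∈ USphere) :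
    Quaternion.normSq (p + I * q) = Quaternion.normSq p + Quaternion.normSq q
      - 2 * (I.imI * (q * star p).imI + I.imJ * (q * star p).imJ + I.imK * (q * star p).imK) := by
  have h0 := USphere_re hI
  have h1 := USphere_im hI
  have h2 : Quaternion.normSq (I * q) = Quaternion.normSq q := by
    rw [map_mul, Quaternion.normSq_def' I, h0]
    rw [show (0:ℝ)^2 + I.imI^2 + I.imJ^2 + I.imK^2 = 1 by linarith, one_mul]
  have h3 : Quaternion.normSq (p + I * q) = Quaternion.normSq p + Quaternion.normSq (I * q)
    - 2 * (I.imI * (q * star p).imI + I.imJ * (q * star p).imJ + I.imK * (q * star p).imK) := by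
    simp only [Quaternion.normSq_def']
    simp [h0]
    ring
  rw [h3, h2]

lemma im_comm (p q : Quaternion ℝ) :
    (q * star p).imI ^ 2 + (q * star p).imJ ^ 2 + (q * star p).imK ^ 2 =
    (star p * q).imI ^ 2 + (star p * q).imJ ^ 2 + (star p * q).imK ^ 2 := by
  simp
  ring

lemma XX_norm {H : Fin 4 → ℝ → ℂ} {t : ℝ} (h : XX H t) {I : Quaternion ℝ} (hI : I ∈ USphere) :
    ‖fst4 H I t‖ = 1 := by
  obtain ⟨h0, h1⟩ := h
  have e1 : (star (alp H t) * bet H t).imI = 0 := h1 1 (by decide)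
  have e2 : (star (alp H t) * bet H t).imJ = 0 := h1 2 (by decide)
  have e3 : (star (alp H t) * bet H t).imK = 0 := h1 3 (by decide)
  have hc := im_comm (alp H t) (bet H t)
  rw [e1, e2, e3] at hc
  have f1 : (bet H t * star (alp H t)).imI = 0 := by
    apply pow_eq_zero_iff (two_ne_zero) |>.mp
    apply le_antisymm _ (sq_nonneg _)
    nlinarith [sq_nonneg (bet H t * star (alp H t)).imJ, sq_nonneg (bet H t * star (alp H t)).imK]
  have f2 : (bet H t * star (alp H t)).imJ = 0 := by
    apply pow_eq_zero_iff (two_ne_zero) |>.mp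
    apply le_antisymm _ (sq_nonneg _)
    nlinarith [sq_nonneg (bet H t * star (alp H t)).imI, sq_nonneg (bet H t * star (alp H t)).imK]
  have f3 : (bet H t * star (alp H t)).imK = 0 := by
    apply pow_eq_zero_iff (two_ne_zero) |>.mp
    apply le_antisymm _ (sq_nonneg _)
    nlinarith [sq_nonneg (bet H t * star (alp H t)).imI, sq_nonneg (bet H t * star (alp H t)).imJ]
  have := norm_alg (alp H t) (bet H t) I hI
  rw [f1, f2, f3, h0, ← fst4_eq, Quaternion.normSq_eq_norm_mul_self] at this
  have hn := norm_nonneg (fst4 H I t)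
  nlinarith

lemma XX_of {H : Fin 4 → ℝ → ℂ} {t : ℝ}
    (h0 : Quaternion.normSq (alp H t) + Quaternion.normSq (bet H t) = 1)
    (f1 : (bet H t * star (alp H t)).imI = 0) (f2 : (bet H t * star (alp H t)).imJ = 0)
    (f3 : (bet H t * star (alp H t)).imK = 0) : XX H t := by
  refine ⟨h0, ?_⟩
  have hc := im_comm (alp H t) (bet H t)
  rw [f1, f2, f3] at hc
  have e1 : (star (alp H t) * bet H t).imI = 0 := by
    apply pow_eq_zero_iff (two_ne_zero) |>.mp
    apply le_antisymm _ (sq_nonneg _)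
    nlinarith [sq_nonneg (star (alp H t) * bet H t).imJ, sq_nonneg (star (alp H t) * bet H t).imK]
  have e2 : (star (alp H t) * bet H t).imJ = 0 := by
    apply pow_eq_zero_iff (two_ne_zero) |>.mp
    apply le_antisymm _ (sq_nonneg _)
    nlinarith [sq_nonneg (star (alp H t) * bet H t).imI, sq_nonneg (star (alp H t) * bet H t).imK]
  have e3 : (star (alp H t) * bet H t).imK = 0 := by
    apply pow_eq_zero_iff (two_ne_zero) |>.mp
    apply le_antisymm _ (sq_nonneg _)
    nlinarith [sq_nonneg (star (alp H t) * bet H t).imI, sq_nonneg (star (alp H t) * bet H t).imJ]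
  intro j hj
  fin_cases j
  · exact absurd rfl hj
  · exact e1
  · exact e2
  · exact e3

lemma fhat_const (c : ℂ) (n : ℤ) : fhat (fun _ => c) n = if n = 0 then c else 0 := by
  have hpi : (Real.pi : ℂ) ≠ 0 := by exact_mod_cast Real.pi_ne_zero
  unfold fhat
  rw [intervalIntegral.integral_mul_const]
  split_ifs with h
  · subst h
    simp
    field_simp
  · have hn : (n : ℂ) ≠ 0 := by exact_mod_cast h
    have e : ∀ x : ℝ, Complex.exp (-(n * x * Complex.I)) = Complex.exp ((-(n * Complex.I)) * x) := by
      intro x; congr 1; ring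
    simp only [e]
    rw [integral_exp_mul_complex (by simp [hn])]
    have : -(n * Complex.I) * ((2 * Real.pi : ℝ) : ℂ) = ((-n : ℤ) : ℂ) * (2 * Real.pi * Complex.I) := by
      push_cast; ring
    rw [this, Complex.exp_int_mul_two_pi_mul_I]
    simp

lemma fhat_star (u : ℝ → ℂ) (n : ℤ) : fhat (fun t => star (u t)) n = star (fhat u (-n)) := by
  unfold fhat
  rw [intervalIntegral.integral_of_le Real.two_pi_pos.le, intervalIntegral.integral_of_le Real.two_pi_pos.le,
    star_mul']
  have h : ∀ z : ℂ, star z = (starRingEnd ℂ) z := fun z => rfl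
  simp only [h]
  rw [← integral_conj, Complex.conj_ofReal]
  congr 2
  funext t
  rw [map_mul, ← Complex.exp_conj]
  congr 2
  simp

lemma VV_star (H : Fin 4 → ℝ → ℂ) (j : Fin 4) (t : ℝ) :
    star (VV H j t) = (if j = 0 then 1 else -1) * VV H j t := by
  by_cases hj : j = 0
  · subst hj
    rw [VV_zero]
    show (starRingEnd ℂ) _ = _
    rw [Complex.conj_ofReal]; simp
  · rw [VV_pos _ _ _ hj]
    show (starRingEnd ℂ) _ = _
    rw [map_mul, Complex.conj_ofReal, Complex.conj_I]; simp [hj]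

lemma cq_delta (k : ℕ) (j : Fin 4) : cq (if k = 0 then 1 else 0) j = if k = 0 then (if j = 0 then 1 else 0) else 0 := by
  split_ifs with h1 h2
  · subst h2; rfl
  · fin_cases j
    · exact absurd rfl h2
    all_goals rfl
  · fin_cases j <;> rfl

lemma cq_inj {p q : Quaternion ℝ} (h : ∀ j, cq p j = cq q j) : p = q := by
  rw [← cq_sum p, ← cq_sum q]
  simp only [h]

lemma mom_of_XX {a : ℕ → Quaternion ℝ} {H : Fin 4 → ℝ → ℂ} (hH : IsBd4 a H) (hX : ∀ᵐ t ∂(volume.restrict (Set.Ico 0 (2 * Real.pi))), XX H t) (k : ℕ) :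
    QQ a k = if k = 0 then 1 else 0 := by
  apply cq_inj
  intro j
  apply Complex.ofReal_injective
  rw [← fhat_VV hH, cq_delta]
  have : fhat (VV H j) (-(k:ℤ)) = fhat (fun _ => if j = 0 then 1 else 0) (-(k:ℤ)) := by
    unfold fhat
    congr 1
    rw [intervalIntegral.integral_of_le Real.two_pi_pos.le, intervalIntegral.integral_of_le Real.two_pi_pos.le,
      ← integral_Ico_eq_integral_Ioc, ← integral_Ico_eq_integral_Ioc]
    apply integral_congr_ae
    filter_upwards [hX] with t ht
    rw [(XX_iff H t).mp ht j]
  rw [this, fhat_const]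
  simp only [neg_eq_zero, Int.natCast_eq_zero]
  split_ifs <;> simp

lemma XX_of_mom {a : ℕ → Quaternion ℝ} {H : Fin 4 → ℝ → ℂ} (hH : IsBd4 a H)
    (hQ : ∀ k : ℕ, QQ a k = if k = 0 then 1 else 0) : ∀ᵐ t, XX H t := by
  have h1 : ∀ (j : Fin 4) (k : ℕ), fhat (VV H j) (-(k:ℤ)) = if k = 0 then (if j = 0 then 1 else 0) else 0 := by
    intro j k
    rw [fhat_VV hH, hQ, cq_delta]
    split_ifs <;> simp
  have h2 : ∀ (j : Fin 4) (n : ℤ), fhat (VV H j) n = if n = 0 then (if j = 0 then 1 else 0) else 0 := by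
    intro j n
    rcases le_total n 0 with hn | hn
    · obtain ⟨k, rfl⟩ : ∃ k : ℕ, n = -(k : ℤ) := ⟨(-n).toNat, by omega⟩
      rw [h1]; simp
    · obtain ⟨k, rfl⟩ : ∃ k : ℕ, n = (k : ℤ) := ⟨n.toNat, by omega⟩
      have e := fhat_star (VV H j) k
      rw [h1] at e
      have e2 : fhat (fun t => star (VV H j t)) k = (if j = 0 then 1 else -1) * fhat (VV H j) k := by
        simp only [VV_star]
        unfold fhat
        rw [mul_left_comm]
        congr 1
        rw [← intervalIntegral.integral_const_mul]
        congr 1; funext t; ring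
      rw [e2] at e
      by_cases hj : j = 0
      · simp only [hj, if_true, one_mul] at e ⊢
        rw [e]; simp only [Int.natCast_eq_zero]; split_ifs <;> simp
      · simp only [hj, if_false] at e ⊢
        simp at e ⊢
        exact e
  have h3 : ∀ j, ∀ᵐ t, VV H j t = if j = 0 then 1 else 0 := by
    intro j
    have := fourier_unique (fun t => VV H j t - if j = 0 then 1 else 0) (by
      intro t; simp only [VV_per hH j t]) (fun u v => (VV_int hH j u v).sub (by simp)) (by
      intro n
      have e : fhat (fun t => VV H j t - if j = 0 then 1 else 0) n = fhat (VV H j) n - fhat (fun _ => if j = 0 then 1 else 0) n := by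
        unfold fhat
        rw [← mul_sub, ← intervalIntegral.integral_sub]
        · congr 2; funext t; ring
        · exact (VV_int hH j _ _).continuousOn_mul (Continuous.continuousOn (by fun_prop))
        · exact Continuous.intervalIntegrable (by fun_prop) _ _
      rw [e, h2, fhat_const, sub_self])
    filter_upwards [this] with t ht
    exact sub_eq_zero.mp ht
  filter_upwards [ae_all_iff.mpr h3] with t ht
  exact (XX_iff H t).mpr ht

def vq (x y z : ℝ) : Quaternion ℝ := ⟨0, x, y, z⟩
lemma vq_re (x y z : ℝ) : (vq x y z).re = 0 := rfl
lemma vq_imI (x y z : ℝ) : (vq x y z).imI = x := rfl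
lemma vq_imJ (x y z : ℝ) : (vq x y z).imJ = y := rfl
lemma vq_imK (x y z : ℝ) : (vq x y z).imK = z := rfl

lemma vq_sum (x y z : ℝ) : vq x y z = x • vq 1 0 0 + y • vq 0 1 0 + z • vq 0 0 1 := by
  ext <;> simp [vq_re, vq_imI, vq_imJ, vq_imK]

lemma vq_mem {x y z : ℝ} (h : x ^ 2 + y ^ 2 + z ^ 2 = 1) : vq x y z ∈ USphere := by
  rw [mem_USphere_iff, vq_re, vq_imI, vq_imJ, vq_imK]
  exact ⟨rfl, h⟩

lemma hausd_pi (s : Set (Fin 2 → ℝ)) : μH[2] s = volume s := by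
  have := MeasureTheory.hausdorffMeasure_pi_real (ι := Fin 2)
  rw [← this]; simp

noncomputable def sphPar (x : Fin 2 → ℝ) : Quaternion ℝ :=
  vq (Real.sin (x 0) * Real.cos (x 1)) (Real.sin (x 0) * Real.sin (x 1)) (Real.cos (x 0))

lemma sphPar_contDiff : ContDiff ℝ 1 sphPar := by
  have : sphPar = fun x => (Real.sin (x 0) * Real.cos (x 1)) • vq 1 0 0 +
      (Real.sin (x 0) * Real.sin (x 1)) • vq 0 1 0 + (Real.cos (x 0)) • vq 0 0 1 := by
    funext x; exact vq_sum _ _ _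
  rw [this]
  fun_prop

lemma USphere_subset : USphere ⊆ sphPar '' Metric.closedBall 0 4 := by
  intro I hI
  obtain ⟨h0, h1⟩ := mem_USphere_iff.mp hI
  have hz1 : -1 ≤ I.imK := by nlinarith [sq_nonneg I.imI, sq_nonneg I.imJ]
  have hz2 : I.imK ≤ 1 := by nlinarith [sq_nonneg I.imI, sq_nonneg I.imJ]
  set w : ℂ := ⟨I.imI, I.imJ⟩ with hw
  have hnw : ‖w‖ = Real.sin (Real.arccos I.imK) := by
    rw [Real.sin_arccos, Complex.norm_eq_sqrt_sq_add_sq]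
    congr 1; simp [hw]; linarith
  refine ⟨![Real.arccos I.imK, Complex.arg w], ?_, ?_⟩
  · rw [mem_closedBall_zero_iff, pi_norm_le_iff_of_nonneg (by norm_num)]
    intro i
    have hp := Real.pi_lt_four
    fin_cases i
    · simp only [Fin.zero_eta, Matrix.cons_val_zero, Real.norm_eq_abs]
      rw [abs_of_nonneg (Real.arccos_nonneg _)]
      linarith [Real.arccos_le_pi I.imK]
    · simp only [Fin.mk_one, Matrix.cons_val_one, Real.norm_eq_abs]
      exact le_trans (Complex.abs_arg_le_pi w) hp.le
  · unfold sphPar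
    simp only [Matrix.cons_val_zero, Matrix.cons_val_one]
    rw [← hnw, Complex.norm_mul_cos_arg, Complex.norm_mul_sin_arg, Real.cos_arccos hz1 hz2]
    ext
    · rw [vq_re, h0]
    · rw [vq_imI]
    · rw [vq_imJ]
    · rw [vq_imK]

lemma USphere_finite : μH[2] USphere < ∞ := by
  obtain ⟨K, hK⟩ := (sphPar_contDiff.contDiffOn (s := Metric.closedBall 0 4)).exists_lipschitzOnWith
    (by norm_num) (convex_closedBall _ _) (isCompact_closedBall _ _)
  refine lt_of_le_of_lt (measure_mono USphere_subset) ?_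
  refine lt_of_le_of_lt (hK.hausdorffMeasure_image_le (d := 2) (by norm_num)) ?_
  rw [hausd_pi]
  exact ENNReal.mul_lt_top (by simp) (isCompact_closedBall _ _).measure_lt_top

lemma USphere_closed : IsClosed USphere :=
  isClosed_eq (by fun_prop) continuous_const

instance sphMeas_sfinite : SFinite sphMeasure := by
  have : IsFiniteMeasure ((μH[2] : Measure (Quaternion ℝ)).restrict USphere) :=
    ⟨by simpa using USphere_finite⟩
  unfold sphMeasure
  infer_instance

lemma ae_sph {p : Quaternion ℝ → Prop} :
    (∀ᵐ I ∂sphMeasure, p I) ↔ ∀ᵐ I ∂((μH[2] : Measure (Quaternion ℝ)).restrict USphere), p I := by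
  unfold sphMeasure
  rw [Measure.ae_ennreal_smul_measure_iff (ENNReal.inv_ne_zero.mpr USphere_finite.ne)]

lemma ae_sph_mem : ∀ᵐ I ∂sphMeasure, I ∈ USphere := by
  rw [ae_sph]
  exact ae_restrict_mem USphere_closed.measurableSet

def projL : Quaternion ℝ →ₗ[ℝ] (Fin 2 → ℝ) where
  toFun q := ![q.imI, q.imJ]
  map_add' p q := by ext i; fin_cases i <;> simp
  map_smul' c q := by ext i; fin_cases i <;> simp

lemma sph_everywhere {g : Quaternion ℝ → ℝ} (hg : Continuous g)
    (h : ∀ᵐ I ∂sphMeasure, g I = 0) (e x y : ℝ) (he : e ^ 2 = 1) (hxy : x ^ 2 + y ^ 2 < 1) :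
    g (vq x y (e * Real.sqrt (1 - x ^ 2 - y ^ 2))) = 0 := by
  rw [ae_sph, ae_restrict_iff' USphere_closed.measurableSet, ae_iff] at h
  set B : Set (Quaternion ℝ) := {I | ¬ (I ∈ USphere → g I = 0)} with hB
  let P : Quaternion ℝ →L[ℝ] (Fin 2 → ℝ) := LinearMap.toContinuousLinearMap projL
  let s : (Fin 2 → ℝ) → Quaternion ℝ := fun u => vq (u 0) (u 1) (e * Real.sqrt (1 - (u 0) ^ 2 - (u 1) ^ 2))
  have hs : Continuous s := by
    have : s = fun u => (u 0) • vq 1 0 0 + (u 1) • vq 0 1 0 +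
      (e * Real.sqrt (1 - (u 0) ^ 2 - (u 1) ^ 2)) • vq 0 0 1 := by
      funext u; exact vq_sum _ _ _
    rw [this]
    fun_prop
  let U : Set (Fin 2 → ℝ) := {u | (u 0) ^ 2 + (u 1) ^ 2 < 1} ∩ {u | g (s u) ≠ 0}
  have hU : IsOpen U := by
    apply IsOpen.inter
    · exact isOpen_lt (by fun_prop) continuous_const
    · exact isOpen_ne_fun (hg.comp hs) continuous_const
  have hsub : U ⊆ P '' B := by
    rintro u ⟨hu1, hu2⟩
    refine ⟨s u, ?_, ?_⟩
    · simp only [hB, Set.mem_ofPred_eq, Classical.not_imp]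
      refine ⟨vq_mem ?_, hu2⟩
      have hu1' : (u 0) ^ 2 + (u 1) ^ 2 < 1 := hu1
      rw [mul_pow, he, Real.sq_sqrt (by linarith)]; ring
    · show ![(s u).imI, (s u).imJ] = u
      ext i; fin_cases i <;> simp [s, vq_imI, vq_imJ]
  have hz : volume U = 0 := by
    rw [← hausd_pi]
    refine measure_mono_null hsub ?_
    have := P.lipschitz.hausdorffMeasure_image_le (d := 2) (by norm_num) B
    rw [h, mul_zero] at this
    exact le_antisymm this bot_le
  have hemp := (hU.measure_eq_zero_iff volume).mp hz
  by_contra hne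
  have : (![x, y] : Fin 2 → ℝ) ∈ U := by
    refine ⟨?_, ?_⟩
    · simpa using hxy
    · simpa [s] using hne
  rw [hemp] at this
  exact this

lemma norm_alg_all {p q : Quaternion ℝ} (h : ∀ᵐ I ∂sphMeasure, ‖p + I * q‖ = 1) :
    Quaternion.normSq p + Quaternion.normSq q = 1 ∧ (q * star p).imI = 0 ∧ (q * star p).imJ = 0 ∧
      (q * star p).imK = 0 := by
  have h' : ∀ᵐ I ∂sphMeasure, ‖p + I * q‖ * ‖p + I * q‖ - 1 = 0 := by
    filter_upwards [h] with I hI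
    rw [hI]; norm_num
  have key := sph_everywhere (g := fun I => ‖p + I * q‖ * ‖p + I * q‖ - 1) (by fun_prop) h'
  have key2 : ∀ e x y z : ℝ, e ^ 2 = 1 → x ^ 2 + y ^ 2 < 1 → 0 ≤ z → z ^ 2 = 1 - x ^ 2 - y ^ 2 →
      Quaternion.normSq p + Quaternion.normSq q - 2 * (x * (q * star p).imI +
        y * (q * star p).imJ + e * z * (q * star p).imK) = 1 := by
    intro e x y z he hxy hz hz2
    have k := key e x y he hxy
    rw [← hz2, Real.sqrt_sq hz] at k
    beta_reduce at k
    rw [← Quaternion.normSq_eq_norm_mul_self, norm_alg p q _ (vq_mem (by rw [mul_pow, he, hz2]; ring)),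
      vq_imI, vq_imJ, vq_imK] at k
    linarith
  have k1 := key2 1 0 0 1 (by norm_num) (by norm_num) (by norm_num) (by norm_num)
  have k2 := key2 (-1) 0 0 1 (by norm_num) (by norm_num) (by norm_num) (by norm_num)
  have k3 := key2 1 (3/5) 0 (4/5) (by norm_num) (by norm_num) (by norm_num) (by norm_num)
  have k4 := key2 1 0 (3/5) (4/5) (by norm_num) (by norm_num) (by norm_num) (by norm_num)
  refine ⟨?_, ?_, ?_, ?_⟩ <;> linarith

lemma ptOn_cont : Continuous (fun p : ℝ × Quaternion ℝ => ptOn p.2 p.1) := by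
  unfold ptOn
  have : Continuous (fun x : ℝ => (x : Quaternion ℝ)) := Quaternion.continuous_coe
  exact (this.comp (by fun_prop)).add (by fun_prop)

lemma two_pi_c : (ENNReal.ofReal (2 * Real.pi))⁻¹ ≠ 0 :=
  ENNReal.inv_ne_zero.mpr ENNReal.ofReal_ne_top

lemma XX_of_inner {a : ℕ → Quaternion ℝ} {H : Fin 4 → ℝ → ℂ} (hH : IsBd4 a H) (hi : IsInnerQ a) :
    ∀ᵐ t ∂(volume.restrict (Set.Ico 0 (2 * Real.pi))), XX H t := by
  have h := hi.2.2
  unfold SigmaBd at h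
  rw [Measure.ae_ennreal_smul_measure_iff two_pi_c] at h
  have h2 := Measure.ae_ae_of_ae_prod (ae_of_ae_map ptOn_cont.measurable.aemeasurable h)
  filter_upwards [h2, ae_restrict_of_ae (bd_good hH)] with t ht hb
  have : ∀ᵐ I ∂sphMeasure, ‖alp H t + I * bet H t‖ = 1 := by
    filter_upwards [ht, ae_sph_mem] with I h1 hI
    rw [← fst4_eq, ← hb I hI]; exact h1
  obtain ⟨h0, f1, f2, f3⟩ := norm_alg_all this
  exact XX_of h0 f1 f2 f3

lemma norm_sq_comp (q : Quaternion ℝ) : ‖q‖ ^ 2 = q.re ^ 2 + q.imI ^ 2 + q.imJ ^ 2 + q.imK ^ 2 := by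
  rw [← Quaternion.normSq_def', Quaternion.normSq_eq_norm_mul_self, sq]

lemma qI_mem : qI ∈ USphere := vq_mem (x := 1) (y := 0) (z := 0) (by norm_num)

lemma exists_ptOn (q : Quaternion ℝ) (hq : ‖q‖ = 1) : ∃ I ∈ USphere, q = ptOn I (Real.arccos q.re) := by
  have hn := norm_sq_comp q
  rw [hq] at hn
  have h1 : -1 ≤ q.re := by nlinarith [sq_nonneg q.imI, sq_nonneg q.imJ, sq_nonneg q.imK]
  have h2 : q.re ≤ 1 := by nlinarith [sq_nonneg q.imI, sq_nonneg q.imJ, sq_nonneg q.imK]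
  set s := Real.sin (Real.arccos q.re) with hs
  have hs2 : s ^ 2 = q.imI ^ 2 + q.imJ ^ 2 + q.imK ^ 2 := by
    rw [hs, Real.sin_arccos, Real.sq_sqrt (by nlinarith)]; linarith
  by_cases h0 : s = 0
  · refine ⟨qI, qI_mem, ?_⟩
    have e1 : q.imI = 0 := by rw [h0] at hs2; nlinarith [sq_nonneg q.imI, sq_nonneg q.imJ, sq_nonneg q.imK]
    have e2 : q.imJ = 0 := by rw [h0] at hs2; nlinarith [sq_nonneg q.imI, sq_nonneg q.imJ, sq_nonneg q.imK]
    have e3 : q.imK = 0 := by rw [h0] at hs2; nlinarith [sq_nonneg q.imI, sq_nonneg q.imJ, sq_nonneg q.imK]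
    unfold ptOn
    rw [← hs, h0, Real.cos_arccos h1 h2]
    ext <;> simp [e1, e2, e3]
  · refine ⟨vq (q.imI / s) (q.imJ / s) (q.imK / s), vq_mem ?_, ?_⟩
    · field_simp; linarith
    · unfold ptOn
      rw [← hs, Real.cos_arccos h1 h2]
      ext <;> simp [vq_re, vq_imI, vq_imJ, vq_imK] <;> field_simp

lemma norm_ptOn {I : Quaternion ℝ} (hI : I ∈ USphere) (t : ℝ) : ‖ptOn I t‖ = 1 ∧ (ptOn I t).re = Real.cos t := by
  obtain ⟨h0, h1⟩ := mem_USphere_iff.mp hI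
  have hre : (ptOn I t).re = Real.cos t := by simp [ptOn, h0]
  refine ⟨?_, hre⟩
  have := norm_sq_comp (ptOn I t)
  rw [hre] at this
  simp [ptOn] at this
  have h2 : ‖ptOn I t‖ ^ 2 = 1 := by
    unfold ptOn
    rw [this]
    nlinarith [Real.sin_sq_add_cos_sq t]
  nlinarith [norm_nonneg (ptOn I t)]

lemma arccos_null {T : Set ℝ} (hT : volume T = 0) :
    ∀ᵐ t ∂(volume.restrict (Set.Ico 0 (2 * Real.pi))), Real.arccos (Real.cos t) ∉ T := by
  have h1 : ∀ᵐ t : ℝ, t ∉ T := measure_eq_zero_iff_ae_notMem.mp hT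
  have h2 : ∀ᵐ t : ℝ, 2 * Real.pi - t ∉ T :=
    (Measure.measurePreserving_sub_left volume (2 * Real.pi)).quasiMeasurePreserving.ae h1
  filter_upwards [ae_restrict_of_ae h1, ae_restrict_of_ae h2, ae_restrict_mem measurableSet_Ico] with t a b c
  by_cases ht : t ≤ Real.pi
  · rwa [Real.arccos_cos c.1 ht]
  · rw [← Real.cos_two_pi_sub, Real.arccos_cos (by linarith [c.2]) (by linarith)]
    exact b

lemma inner_of_XX {a : ℕ → Quaternion ℝ} {H : Fin 4 → ℝ → ℂ} (ha : MemH2 a) (hH : IsBd4 a H)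
    (hX : ∀ᵐ t : ℝ, XX H t) : IsInnerQ a := by
  refine ⟨ha, ?_, ?_⟩
  · intro q hq
    have hq' : ‖q‖ < 1 := hq
    obtain ⟨I, hI, t, hqt⟩ : ∃ I ∈ USphere, ∃ t, q = ((‖q‖ : ℝ) : Quaternion ℝ) * ptOn I t := by
      by_cases h0 : q = 0
      · exact ⟨qI, qI_mem, 0, by simp [h0]⟩
      · have hn : ‖q‖ ≠ 0 := norm_ne_zero_iff.mpr h0
        obtain ⟨I, hI, e⟩ := exists_ptOn (‖q‖⁻¹ • q) (by rw [norm_smul, norm_inv, norm_norm, inv_mul_cancel₀ hn])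
        refine ⟨I, hI, Real.arccos (‖q‖⁻¹ • q).re, ?_⟩
        rw [← e, Quaternion.coe_mul_eq_smul, smul_smul, mul_inv_cancel₀ hn, one_smul]
    rw [hqt, evalS_pois hH hI (norm_nonneg q) hq' t]
    have hb : ∀ᵐ s : ℝ, ‖fst4 H I (t + s)‖ = 1 := by
      have := (measurePreserving_add_left volume t).quasiMeasurePreserving.ae hX
      filter_upwards [this] with s hs
      exact XX_norm hs hI
    have hle := intervalIntegral.norm_integral_le_of_norm_le (μ := volume) (a := -Real.pi) (b := Real.pi)
      (f := fun s => poisP ‖q‖ s • fst4 H I (t + s)) (g := fun s => poisP ‖q‖ s)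
      (by linarith [Real.pi_pos])
      (by
        filter_upwards [hb] with s hs _
        rw [norm_smul, hs, mul_one, Real.norm_of_nonneg (poisP_nonneg (norm_nonneg q) hq' s)])
      ((poisP_cont (norm_nonneg q) hq').intervalIntegrable _ _)
    rw [poisP_integral (norm_nonneg q) hq'] at hle
    have hp : 0 < 2 * Real.pi := by positivity
    rw [norm_smul, Real.norm_of_nonneg (by positivity)]
    calc _ ≤ (2 * Real.pi)⁻¹ * (2 * Real.pi) := by gcongr
      _ = 1 := inv_mul_cancel₀ hp.ne'
  · unfold SigmaBd
    rw [Measure.ae_ennreal_smul_measure_iff two_pi_c]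
    have hbad : ∀ᵐ t : ℝ, XX H t ∧ ∀ I ∈ USphere, bdval a (ptOn I t) = fst4 H I t := hX.and (bd_good hH)
    rw [ae_iff] at hbad
    set B := {t : ℝ | ¬ (XX H t ∧ ∀ I ∈ USphere, bdval a (ptOn I t) = fst4 H I t)} with hB
    set T := toMeasurable volume B
    have hT : volume T = 0 := by rw [measure_toMeasurable, hbad]
    have hTm : MeasurableSet T := measurableSet_toMeasurable _ _
    have hre : Continuous (fun q : Quaternion ℝ => Real.arccos q.re) :=
      Real.continuous_arccos.comp Quaternion.continuous_re
    have hms : MeasurableSet {q : Quaternion ℝ | ‖q‖ = 1 ∧ Real.arccos q.re ∉ T} :=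
      (measurableSet_eq_fun continuous_norm.measurable measurable_const).inter
        (hre.measurable hTm.compl)
    have key : ∀ᵐ q ∂(Measure.map (fun p : ℝ × Quaternion ℝ => ptOn p.2 p.1)
      ((volume.restrict (Set.Ico 0 (2 * Real.pi))).prod sphMeasure)), ‖q‖ = 1 ∧ Real.arccos q.re ∉ T := by
      rw [ae_map_iff ptOn_cont.measurable.aemeasurable hms]
      filter_upwards [Measure.quasiMeasurePreserving_fst.ae (arccos_null hT),
        Measure.quasiMeasurePreserving_snd.ae ae_sph_mem] with p h1 h2
      obtain ⟨e1, e2⟩ := norm_ptOn h2 p.1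
      exact ⟨e1, by rw [e2]; exact h1⟩
    filter_upwards [key] with q hq
    obtain ⟨I, hI, e⟩ := exists_ptOn q hq.1
    have hnB : Real.arccos q.re ∉ B := fun h => hq.2 (subset_toMeasurable _ _ h)
    simp only [hB, Set.mem_ofPred_eq, not_not] at hnB
    rw [e, hnB.2 I hI]
    exact XX_norm hnB.1 hI

/-- For `f ∈ H²(𝔹)` the following are equivalent: (i) `f` is inner;
(ii) `⟨qᵏ * f, f⟩ = δ_k(0)` for all `k ∈ ℕ`;
(iii) there exists `I ∈ 𝕊` with `⟨qᵏ * f, f⟩_I = δ_k(0)` for all `k ∈ ℕ`, where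
`⟨·,·⟩_I` is the slice integral inner product. -/
theorem inner_iff_moments (a : ℕ → Quaternion ℝ) (ha : MemH2 a) :
    [ IsInnerQ a,
      ∀ k : ℕ, h2inner (sProd (qpow k) a) a = if k = 0 then 1 else 0,
      ∃ I ∈ USphere, ∀ k : ℕ,
        sliceInnerPow a I k = if k = 0 then 1 else 0 ].TFAE := by
  obtain ⟨H, hH⟩ := isBd4_exists a ha
  tfae_have 1 → 2 := by
    intro h k
    rw [moment_eq hH k]
    exact mom_of_XX hH (XX_of_inner hH h) k
  tfae_have 2 → 1 := by
    intro h
    refine inner_of_XX ha hH (XX_of_mom hH fun k => ?_)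
    rw [← moment_eq hH k]
    exact h k
  tfae_have 2 → 3 := by
    intro h
    refine ⟨qI, qI_mem, fun k => ?_⟩
    rw [slice_eq hH qI_mem k, ← moment_eq hH k]
    exact h k
  tfae_have 3 → 2 := by
    rintro ⟨I, hI, h⟩ k
    rw [moment_eq hH k, ← slice_eq hH hI k]
    exact h k
  tfae_finish
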